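/- arXiv:q-alg/9708018 — 3 statements merged into one kernel-verified Lean document; each statement's English description precedes it below -/
import Mathlib

section
/- Define the Okamoto polynomials Q_{m,n}(x) := N_{m,n}·s_{m,n}(x) for m, n ∈ ℤ, where N_{m,n} is the product of the hook lengths of λ(m,n). Then Q_{0,0} = Q_{1,0} = Q_{1,1} = 1 and Q_{2,1}(x) = x, and for all m, n ∈ ℤ the three Toda equations hold identically in x: Q_{m,n}''·Q_{m,n} − (Q_{m,n}')² + (x² − 1 + 2m − n)·Q_{m,n}² = Q_{m+1,n}·Q_{m−1,n}; Q_{m,n}''·Q_{m,n} − (Q_{m,n}')² + (x² − m + 2n)·Q_{m,n}² = Q_{m,n+1}·Q_{m,n−1}; and Q_{m,n}''·Q_{m,n} − (Q_{m,n}')² + (x² + 1 − m − n)·Q_{m,n}² = Q_{m−1,n−1}·Q_{m+1,n+1}. -/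
/-- `p2 c n` is the two-variable polynomial `p_n(t₁, t₂) = ∑_{i+2j=n} t₁^i t₂^j/(i!·j!)`
with the second variable specialized to `t₂ = c`, as a polynomial in `x = t₁`. -/
noncomputable def p2 (c : ℂ) (n : ℕ) : Polynomial ℂ :=
  ∑ j ∈ Finset.range (n / 2 + 1),
    Polynomial.C (c ^ j / ((Nat.factorial (n - 2 * j) : ℂ) * (Nat.factorial j : ℂ))) *
      Polynomial.X ^ (n - 2 * j)

/-- `p_m(x, c)` for an integer index, with `p_m = 0` for `m < 0`. -/
noncomputable def p2Z (c : ℂ) (m : ℤ) : Polynomial ℂ :=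
  if 0 ≤ m then p2 c m.toNat else 0

/-- The Jacobi–Trudi determinant `S_λ(x, c) = det(p_{λᵢ−i+j}(x, c))_{1≤i,j≤ℓ}`, for a
partition recorded as `lam : ℕ → ℕ` (so `λ_{i+1} = lam i`) of length at most `ℓ`. -/
noncomputable def jacobiTrudi (c : ℂ) (ℓ : ℕ) (lam : ℕ → ℕ) : Polynomial ℂ :=
  Matrix.det (Matrix.of fun i j : Fin ℓ =>
    p2Z c ((lam i : ℤ) - (i : ℕ) + (j : ℕ)))

/-- The Maya diagram `M(m,n) = {3k : k < m} ∪ {3k+1 : k < n} ∪ {3k+2 : k < 0} ⊂ ℤ`. -/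
def mayaSet (m n : ℤ) : Set ℤ :=
  {z | ∃ k < m, z = 3 * k} ∪ {z | ∃ k < n, z = 3 * k + 1} ∪
    {z | ∃ k < (0 : ℤ), z = 3 * k + 2}

/-- `lam : ℕ → ℕ` (with `λ_{i+1} = lam i`) is the partition associated to the Maya
diagram `M`, with `c` the eventually constant value of `mᵢ + i`: i.e. `lam` is weakly
decreasing, eventually `0`, and `i ↦ λ_{i+1} − (i+1) + c` is the (strictly decreasing)
enumeration of `M`, i.e. its range is exactly `M`. -/
def IsMayaPartition (M : Set ℤ) (lam : ℕ → ℕ) (c : ℤ) : Prop :=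
  Antitone lam ∧ (∃ N, ∀ i, N ≤ i → lam i = 0) ∧
    Set.range (fun i : ℕ => (lam i : ℤ) - ((i : ℤ) + 1) + c) = M

/-- `s` is the 3-reduced Schur polynomial `s_{m,n}(x) = S_{λ(m,n)}(x, 1/2)`, where
`λ(m,n)` is the partition associated to the Maya diagram `M(m,n)`. -/
def IsOkamotoS (m n : ℤ) (s : Polynomial ℂ) : Prop :=
  ∃ (lam : ℕ → ℕ) (c : ℤ) (ℓ : ℕ),
    IsMayaPartition (mayaSet m n) lam c ∧ (∀ i, ℓ ≤ i → lam i = 0) ∧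
    s = jacobiTrudi (1 / 2) ℓ lam

/-- The Hirota bilinear expression `(Dₓ² − x·Dₓ − c) F·G` for polynomials. -/
noncomputable def hirotaBil (c : ℂ) (F G : Polynomial ℂ) : Polynomial ℂ :=
  Polynomial.derivative (Polynomial.derivative F) * G -
    2 * Polynomial.derivative F * Polynomial.derivative G +
    F * Polynomial.derivative (Polynomial.derivative G) -
    Polynomial.X * (Polynomial.derivative F * G - F * Polynomial.derivative G) -
    Polynomial.C c * (F * G)

/-- The conjugate partition: `conjPart ℓ lam j = λ′_{j+1} = #{i : λᵢ ≥ j+1}`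
(0-based `j`). -/
def conjPart (ℓ : ℕ) (lam : ℕ → ℕ) (j : ℕ) : ℕ :=
  ((Finset.range ℓ).filter fun i => j + 1 ≤ lam i).card

/-- The product of the hook lengths `h(i,j) = λᵢ − j + λ′ⱼ − i + 1` over all the cells
of the partition `lam` (of length at most `ℓ`). -/
def hookProd (ℓ : ℕ) (lam : ℕ → ℕ) : ℕ :=
  ∏ i ∈ Finset.range ℓ, ∏ j ∈ Finset.range (lam i),
    (lam i - j + conjPart ℓ lam j - i - 1)

/-- `Q` is the Okamoto polynomial `Q_{m,n}(x) = N_{m,n}·s_{m,n}(x)`, where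
`s_{m,n}(x) = S_{λ(m,n)}(x, 1/2)` and `N_{m,n}` is the product of the hook lengths of
the partition `λ(m,n)` associated to the Maya diagram `M(m,n)`. -/
def IsOkamotoQ (m n : ℤ) (Q : Polynomial ℂ) : Prop :=
  ∃ (lam : ℕ → ℕ) (c : ℤ) (ℓ : ℕ),
    IsMayaPartition (mayaSet m n) lam c ∧ (∀ i, ℓ ≤ i → lam i = 0) ∧
    Q = Polynomial.C ((hookProd ℓ lam : ℕ) : ℂ) * jacobiTrudi (1 / 2) ℓ lam

/-- The Toda bilinear expression `Q''·Q − (Q')² + (x² + a)·Q²`,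
i.e. `(½Dₓ² + x² + a) Q·Q` in Hirota notation. -/
noncomputable def todaLHS (a : ℂ) (Q : Polynomial ℂ) : Polynomial ℂ :=
  Polynomial.derivative (Polynomial.derivative Q) * Q -
    Polynomial.derivative Q ^ 2 +
    (Polynomial.X ^ 2 + Polynomial.C a) * Q ^ 2

section

open Polynomial Matrix

theorem derivative_det {n : Type*} [Fintype n] [DecidableEq n] (M : Matrix n n ℂ[X]) :
    derivative M.det = ∑ j, (M.updateCol j fun i => derivative (M i j)).det := by
  simp only [det_apply, derivative_sum, Units.smul_def]
  rw [Finset.sum_comm]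
  refine Finset.sum_congr rfl fun σ _ => ?_
  rw [derivative_smul, derivative_prod_finset, Finset.smul_sum]
  refine Finset.sum_congr rfl fun j _ => ?_
  rw [← Finset.prod_erase_mul _ _ (Finset.mem_univ j), updateCol_self]
  congr 2
  refine Finset.prod_congr rfl fun i hi => ?_
  rw [updateCol_ne (Finset.ne_of_mem_erase hi)]

theorem det_mul_det_fromBlocks_of_field {K n : Type*} [Field K] [Fintype n] [DecidableEq n]
    (A : Matrix n n K) (hA : A.det ≠ 0) (B : Matrix n (Fin 2) K) (C : Matrix (Fin 2) n K)
    (D : Matrix (Fin 2) (Fin 2) K) :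
    A.det * (fromBlocks A B C D).det =
      let m (i j : Fin 2) : K :=
        (fromBlocks A (B.submatrix id fun _ : Fin 1 => j)
          (C.submatrix (fun _ : Fin 1 => i) id) (D.submatrix (fun _ => i) fun _ => j)).det
      m 0 0 * m 1 1 - m 0 1 * m 1 0 := by
  have hu : IsUnit A := (isUnit_iff_isUnit_det A).2 (isUnit_iff_ne_zero.2 hA)
  let _ : Invertible A := hu.invertible
  have hm (i j : Fin 2) :
      (fromBlocks A (B.submatrix id fun _ : Fin 1 => j)
          (C.submatrix (fun _ : Fin 1 => i) id) (D.submatrix (fun _ => i) fun _ => j)).det =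
        A.det * (D - C * ⅟A * B) i j := by
    rw [det_fromBlocks₁₁]
    congr 1
    simp [Matrix.mul_apply]
  simp only [hm, det_fromBlocks₁₁, det_fin_two]
  ring

theorem det_mul_det_fromBlocks {R n : Type*} [CommRing R] [IsDomain R] [Fintype n] [DecidableEq n]
    (A : Matrix n n R) (hA : A.det ≠ 0) (B : Matrix n (Fin 2) R) (C : Matrix (Fin 2) n R)
    (D : Matrix (Fin 2) (Fin 2) R) (m : Fin 2 → Fin 2 → R)
    (hm : ∀ i j, m i j = (fromBlocks A (B.submatrix id fun _ : Fin 1 => j)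
      (C.submatrix (fun _ : Fin 1 => i) id) (D.submatrix (fun _ => i) fun _ => j)).det) :
    A.det * (fromBlocks A B C D).det = m 0 0 * m 1 1 - m 0 1 * m 1 0 := by
  let φ := algebraMap R (FractionRing R)
  have hφ : Function.Injective φ := IsFractionRing.injective R _
  apply hφ
  have h := det_mul_det_fromBlocks_of_field (φ.mapMatrix A)
    (by rwa [← RingHom.map_det, Ne, map_eq_zero_iff φ hφ]) (B.map φ) (C.map φ) (D.map φ)
  simp only [hm, map_sub, map_mul, RingHom.map_det, RingHom.mapMatrix_apply, fromBlocks_map]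
  exact h

/-- The Wronskian determinant of `n` polynomials. -/
noncomputable def wronskianDet {n : ℕ} (f : Fin n → ℂ[X]) : ℂ[X] :=
  det (of fun i j : Fin n => derivative^[j] (f i))

theorem derivative_wronskianDet_succ {n : ℕ} (f : Fin (n + 1) → ℂ[X]) :
    derivative (wronskianDet f) =
      det (of fun i j : Fin (n + 1) => derivative^[if j = Fin.last n then n + 1 else j] (f i)) := by
  rw [wronskianDet, derivative_det, Fin.sum_univ_castSucc, Finset.sum_eq_zero, zero_add]
  · congr 1
    ext1 i j
    by_cases h : j = Fin.last n
    · subst h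
      simp [← Function.iterate_succ_apply' derivative]
    · simp [h]
  · intro j _
    refine det_zero_of_column_eq (i := j.castSucc) (j := j.succ) Fin.castSucc_lt_succ.ne
      fun i => ?_
    rw [updateCol_self, updateCol_ne (Fin.castSucc_lt_succ).ne']
    simp [← Function.iterate_succ_apply' derivative]

theorem wronskianDet_mul_wronskianDet {n : ℕ} (f : Fin n → ℂ[X]) (hf : wronskianDet f ≠ 0)
    (g : Fin 2 → ℂ[X]) :
    wronskianDet f * wronskianDet (Fin.append f g) =
      wronskianDet (Fin.append f fun _ : Fin 1 => g 0) *
          derivative (wronskianDet (Fin.append f fun _ : Fin 1 => g 1)) -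
        derivative (wronskianDet (Fin.append f fun _ : Fin 1 => g 0)) *
          wronskianDet (Fin.append f fun _ : Fin 1 => g 1) := by
  have hl (j : Fin n) : Fin.castAdd 1 j ≠ Fin.last n := (Fin.castSucc_lt_last j).ne
  have hr (j : Fin 1) : Fin.natAdd n j = Fin.last n := by ext; simp
  have hr' (c : ℂ[X]) : Fin.append f (fun _ : Fin 1 => c) (Fin.last n) = c := by
    rw [← hr 0, Fin.append_right]
  have h := det_mul_det_fromBlocks _ hf
    (of fun i (j : Fin 2) => derivative^[n + j] (f i))
    (of fun (i : Fin 2) (j : Fin n) => derivative^[j] (g i))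
    (of fun (i : Fin 2) (j : Fin 2) => derivative^[n + j] (g i))
    (fun i j => ![wronskianDet (Fin.append f fun _ : Fin 1 => g i),
      derivative (wronskianDet (Fin.append f fun _ : Fin 1 => g i))] j) fun i j => by
        fin_cases j
        · refine (det_submatrix_equiv_self finSumFinEquiv _).symm.trans (congrArg det ?_)
          ext1 i j
          rcases i with i | i <;> rcases j with j | j <;> simp
        · refine (derivative_wronskianDet_succ _).trans <|
            (det_submatrix_equiv_self finSumFinEquiv _).symm.trans (congrArg det ?_)
          ext1 i j
          rcases i with i | i <;> rcases j with j | j <;> simp [hl, hr, hr']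
  refine Eq.trans (congrArg _ ?_) h
  refine (det_submatrix_equiv_self finSumFinEquiv _).symm.trans (congrArg det ?_)
  ext1 i j
  rcases i with i | i <;> rcases j with j | j <;> simp

theorem p2_coeff (c : ℂ) (n i : ℕ) :
    (p2 c n).coeff i = if i ≤ n ∧ 2 ∣ n - i then
      c ^ ((n - i) / 2) / (Nat.factorial i * Nat.factorial ((n - i) / 2)) else 0 := by
  rw [p2, finsetSum_coeff]
  simp only [coeff_C_mul_X_pow]
  split_ifs with h
  · obtain ⟨h, j, hj⟩ := h
    rw [Finset.sum_eq_single j]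
    · rw [if_pos (by omega), show (n - i) / 2 = j by omega, show n - 2 * j = i by omega]
    · intro b hb hbj
      rw [Finset.mem_range] at hb
      rw [if_neg (by omega)]
    · intro hb
      rw [Finset.mem_range] at hb
      omega
  · refine Finset.sum_eq_zero fun j hj => if_neg ?_
    rw [Finset.mem_range] at hj
    rintro rfl
    exact h ⟨by omega, j, by omega⟩

theorem derivative_p2_zero (c : ℂ) : derivative (p2 c 0) = 0 := by
  simp [p2]

theorem derivative_p2_succ (c : ℂ) (n : ℕ) : derivative (p2 c (n + 1)) = p2 c n := by
  ext i
  rw [coeff_derivative, p2_coeff, p2_coeff]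
  simp only [Nat.add_le_add_iff_right, Nat.add_sub_add_right]
  split_ifs with h
  · rw [Nat.factorial_succ]
    have : (i : ℂ) + 1 ≠ 0 := Nat.cast_add_one_ne_zero i
    push_cast
    field_simp
  · simp

theorem iterate_derivative_p2 (c : ℂ) (n k : ℕ) :
    derivative^[k] (p2 c n) = p2Z c ((n : ℤ) - k) := by
  induction k generalizing n with
  | zero => simp [p2Z]
  | succ k ih =>
    cases n with
    | zero =>
      rw [Function.iterate_succ_apply, derivative_p2_zero, iterate_derivative_zero, p2Z,
        if_neg (by omega)]
    | succ n =>
      rw [Function.iterate_succ_apply, derivative_p2_succ, ih]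
      congr 1
      push_cast
      ring

theorem p2_half_ode (n : ℕ) :
    derivative (derivative (p2 (1 / 2) n)) + X * derivative (p2 (1 / 2) n) =
      C (n : ℂ) * p2 (1 / 2) n := by
  ext i
  have hX : (X * derivative (p2 (1 / 2) n)).coeff i = (p2 (1 / 2) n).coeff i * i := by
    cases i with
    | zero => simp
    | succ i => rw [coeff_X_mul, coeff_derivative]; push_cast; ring
  rw [coeff_add, hX, coeff_C_mul, coeff_derivative, coeff_derivative, p2_coeff, p2_coeff]
  by_cases h : i ≤ n ∧ 2 ∣ n - i
  · obtain ⟨h, j, hj⟩ := h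
    obtain rfl : n = i + 2 * j := by omega
    rw [if_pos (show i ≤ i + 2 * j ∧ 2 ∣ i + 2 * j - i by omega),
      show (i + 2 * j - i) / 2 = j by omega]
    cases j with
    | zero =>
      rw [if_neg (show ¬(i + 1 + 1 ≤ i + 2 * 0 ∧ 2 ∣ i + 2 * 0 - (i + 1 + 1)) by omega)]
      push_cast
      ring
    | succ j =>
      rw [if_pos (show i + 1 + 1 ≤ i + 2 * (j + 1) ∧ 2 ∣ i + 2 * (j + 1) - (i + 1 + 1) by omega),
        show (i + 2 * (j + 1) - (i + 1 + 1)) / 2 = j by omega]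
      have h1 : (i : ℂ) + 1 ≠ 0 := Nat.cast_add_one_ne_zero i
      have h2 : (i : ℂ) + 1 + 1 ≠ 0 := mod_cast Nat.cast_add_one_ne_zero (R := ℂ) (i + 1)
      have h3 : (j : ℂ) + 1 ≠ 0 := Nat.cast_add_one_ne_zero j
      simp only [Nat.factorial_succ, Nat.cast_mul, Nat.cast_add, Nat.cast_one, Nat.cast_ofNat]
      have := Nat.cast_ne_zero (R := ℂ).2 (Nat.factorial_ne_zero i)
      have := Nat.cast_ne_zero (R := ℂ).2 (Nat.factorial_ne_zero j)
      field_simp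
      ring
  · rw [if_neg h, if_neg (by rintro ⟨h1, j, hj⟩; exact h ⟨by omega, j + 1, by omega⟩)]
    simp

/-- The monic polynomial `n! · p_n(x, 1/2)`. -/
noncomputable def hermiteP (n : ℕ) : ℂ[X] := C (n.factorial : ℂ) * p2 (1 / 2) n

theorem hermiteP_zero : hermiteP 0 = 1 := by simp [hermiteP, p2]

theorem derivative_hermiteP_succ (n : ℕ) :
    derivative (hermiteP (n + 1)) = C ((n : ℂ) + 1) * hermiteP n := by
  simp [hermiteP, derivative_p2_succ, Nat.factorial_succ, mul_assoc]

theorem hermiteP_ode (n : ℕ) :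
    derivative (derivative (hermiteP n)) + X * derivative (hermiteP n) =
      C (n : ℂ) * hermiteP n := by
  simp only [hermiteP, derivative_C_mul]
  linear_combination C (n.factorial : ℂ) * p2_half_ode n

theorem hermiteP_ne_zero (n : ℕ) : hermiteP n ≠ 0 := by
  refine mul_ne_zero (by simpa using Nat.factorial_ne_zero n) fun h => ?_
  have := congrArg (coeff · n) h
  simp [p2_coeff, Nat.factorial_ne_zero] at this

theorem iterate_derivative_hermiteP (n k : ℕ) :
    derivative^[k] (hermiteP n) = C (n.factorial : ℂ) * p2Z (1 / 2) ((n : ℤ) - k) := by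
  rw [hermiteP, iterate_derivative_C_mul, iterate_derivative_p2]

/-- The Vandermonde determinant of a tuple of natural numbers. -/
noncomputable def vander {n : ℕ} (v : Fin n → ℕ) : ℂ := (vandermonde fun i => (v i : ℂ)).det

theorem vander_ne_zero {n : ℕ} {v : Fin n → ℕ} (hv : Function.Injective v) : vander v ≠ 0 :=
  det_vandermonde_ne_zero_iff.2 fun _ _ h => hv (Nat.cast_injective h)

theorem vander_append_one {n : ℕ} (v : Fin n → ℕ) (b : ℕ) :
    vander (Fin.append v fun _ : Fin 1 => b) = vander v * ∏ i, ((b : ℂ) - v i) := by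
  have h (i : Fin n) (F : Fin (n + 1) → ℂ) : ∏ j ∈ Finset.Ioi i.castSucc, F j =
      F (Fin.last n) * ∏ j ∈ Finset.Ioi i, F j.castSucc := by
    have hI : Finset.Ioi i.castSucc =
        insert (Fin.last n) ((Finset.Ioi i).map Fin.castSuccEmb) := by
      ext j
      refine Fin.lastCases ?_ (fun j => ?_) j <;> simp [Fin.castSucc_lt_last, Fin.le_last]
    rw [hI, Finset.prod_insert (by simp), Finset.prod_map]
    rfl
  have hl (F : Fin (n + 1) → ℂ) : ∏ j ∈ Finset.Ioi (Fin.last n), F j = 1 :=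
    Finset.prod_eq_one fun j hj => absurd (Finset.mem_Ioi.1 hj) (Fin.le_last j).not_gt
  rw [Fin.append_right_eq_snoc]
  simp only [vander, det_vandermonde, Fin.prod_univ_castSucc, h, hl]
  simp only [Fin.snoc_castSucc, Fin.snoc_last, Finset.prod_mul_distrib, mul_one]
  ring

theorem vander_append_two {n : ℕ} (v : Fin n → ℕ) (g : Fin 2 → ℕ) :
    vander (Fin.append v g) =
      vander v * (∏ i, ((g 0 : ℂ) - v i)) * (∏ i, ((g 1 : ℂ) - v i)) * ((g 1 : ℂ) - g 0) := by
  have h : Fin.append v g =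
      Fin.append (Fin.append v fun _ : Fin 1 => g 0) (fun _ : Fin 1 => g 1) := by
    rw [Fin.append_assoc]
    congr 1
    ext i
    fin_cases i <;> rfl
  rw [h, vander_append_one, vander_append_one, Fin.prod_univ_castSucc (n := n)]
  have h1 (i : Fin n) : Fin.append v (fun _ : Fin 1 => g 0) i.castSucc = v i := by
    rw [Fin.append_right_eq_snoc, Fin.snoc_castSucc]
  have h2 : Fin.append v (fun _ : Fin 1 => g 0) (Fin.last n) = g 0 := by
    rw [Fin.append_right_eq_snoc, Fin.snoc_last]
  simp only [h1, h2]
  ring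

/-- The monic Wronskian attached to a tuple of distinct degrees. -/
noncomputable def tauFn {n : ℕ} (v : Fin n → ℕ) : ℂ[X] :=
  C (vander v)⁻¹ * wronskianDet (hermiteP ∘ v)

theorem tauFn_comp_perm {n : ℕ} (v : Fin n → ℕ) (σ : Equiv.Perm (Fin n)) :
    tauFn (v ∘ σ) = tauFn v := by
  have h1 : vander (v ∘ σ) = (Equiv.Perm.sign σ : ℤ) * vander v :=
    det_permute σ (vandermonde fun i => (v i : ℂ))
  have h2 : wronskianDet (hermiteP ∘ v ∘ σ) =
      ((Equiv.Perm.sign σ : ℤ) : ℂ[X]) * wronskianDet (hermiteP ∘ v) :=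
    det_permute σ (of fun i j : Fin n => derivative^[j] (hermiteP (v i)))
  rw [tauFn, tauFn, h1, h2]
  rcases Int.units_eq_one_or (Equiv.Perm.sign σ) with h | h <;> simp [h, inv_neg]

/-- The monic Wronskian attached to a finite set of degrees. -/
noncomputable def tau (S : Finset ℕ) : ℂ[X] := tauFn (S.orderEmbOfFin rfl)

theorem tau_eq_tauFn {n : ℕ} {S : Finset ℕ} (hS : S.card = n) {v : Fin n → ℕ}
    (hv : Function.Injective v) (hvS : ∀ i, v i ∈ S) : tau S = tauFn v := by
  subst hS
  have hi : Function.Injective fun i => (S.orderIsoOfFin rfl).symm ⟨v i, hvS i⟩ := fun i j h =>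
    hv (congrArg Subtype.val ((S.orderIsoOfFin rfl).symm.injective h))
  let σ : Equiv.Perm (Fin S.card) := Equiv.ofBijective _ (Finite.injective_iff_bijective.1 hi)
  rw [tau, ← tauFn_comp_perm _ σ]
  congr 1
  ext i
  change ((S.orderIsoOfFin rfl) ((S.orderIsoOfFin rfl).symm ⟨v i, hvS i⟩) : ℕ) = v i
  rw [OrderIso.apply_symm_apply]

theorem tau_empty : tau ∅ = 1 := by
  rw [tau_eq_tauFn (n := 0) (v := ![]) rfl (fun i => i.elim0) fun i => i.elim0]
  simp [tauFn, vander, wronskianDet]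

theorem tau_singleton (b : ℕ) : tau {b} = hermiteP b := by
  rw [tau_eq_tauFn (n := 1) (v := ![b]) rfl (Function.injective_of_subsingleton _) (by simp)]
  simp [tauFn, vander, wronskianDet]

theorem tau_jacobi {S : Finset ℕ} (hS : tau S ≠ 0) {a b : ℕ} (ha : a ∉ S) (hb : b ∉ S)
    (hab : a ≠ b) :
    C ((b : ℂ) - a) * tau S * tau (insert b (insert a S)) =
      tau (insert a S) * derivative (tau (insert b S)) -
        derivative (tau (insert a S)) * tau (insert b S) := by
  obtain ⟨v, hv⟩ : ∃ v : Fin S.card → ℕ, v = S.orderEmbOfFin rfl := ⟨_, rfl⟩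
  have hinj : Function.Injective v := hv ▸ (S.orderEmbOfFin rfl).injective
  have hmem (i) : v i ∈ S := hv ▸ S.orderEmbOfFin_mem rfl i
  have h0 : tau S = tauFn v := by rw [hv, tau]
  have hone {c : ℕ} (hc : c ∉ S) : tau (insert c S) = tauFn (Fin.append v fun _ : Fin 1 => c) := by
    refine tau_eq_tauFn (Finset.card_insert_of_notMem hc) ?_ fun i => ?_
    · rw [Fin.append_right_eq_snoc, Fin.snoc_injective_iff]
      exact ⟨hinj, fun ⟨i, hi⟩ => hc (hi ▸ hmem i)⟩
    · refine Fin.addCases (fun i => ?_) (fun i => ?_) i <;> simp [hmem]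
  have htwo : tau (insert b (insert a S)) = tauFn (Fin.append v ![a, b]) := by
    refine tau_eq_tauFn ?_ ?_ fun i => ?_
    · rw [Finset.card_insert_of_notMem (by simp [hab.symm, hb]), Finset.card_insert_of_notMem ha]
    · rw [Fin.append_injective_iff]
      refine ⟨hinj, ?_, fun i j h => ?_⟩
      · intro i j h
        fin_cases i <;> fin_cases j <;> simp_all
      · fin_cases j
        · have e : v i = a := h
          exact ha (e ▸ hmem i)
        · have e : v i = b := h
          exact hb (e ▸ hmem i)
    · refine Fin.addCases (fun i => ?_) (fun i => ?_) i
      · simp [hmem]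
      · fin_cases i <;> simp
  have hV := vander_ne_zero hinj
  have hprod {c : ℕ} (hc : c ∉ S) : ∏ i, ((c : ℂ) - v i) ≠ 0 :=
    Finset.prod_ne_zero_iff.2 fun i _ h =>
      hc ((Nat.cast_injective (sub_eq_zero.1 h)) ▸ hmem i)
  have hba : (b : ℂ) - a ≠ 0 := sub_ne_zero.2 fun h => hab (Nat.cast_injective h).symm
  have hW : wronskianDet (hermiteP ∘ v) ≠ 0 := fun h => hS (by rw [h0, tauFn, h, mul_zero])
  have happ {m : ℕ} (g : Fin m → ℕ) :
      hermiteP ∘ Fin.append v g = Fin.append (hermiteP ∘ v) (hermiteP ∘ g) := by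
    ext1 i
    refine Fin.addCases (fun i => ?_) (fun i => ?_) i <;> simp
  have hJ := wronskianDet_mul_wronskianDet _ hW (hermiteP ∘ ![a, b])
  rw [htwo, hone ha, hone hb, h0]
  simp only [tauFn, happ, vander_append_one, vander_append_two, derivative_C_mul]
  have hc : C ((b : ℂ) - a) * C (vander v)⁻¹ *
      C (vander v * (∏ i, ((a : ℂ) - v i)) * (∏ i, ((b : ℂ) - v i)) * ((b : ℂ) - a))⁻¹ =
      C (vander v * ∏ i, ((a : ℂ) - v i))⁻¹ * C (vander v * ∏ i, ((b : ℂ) - v i))⁻¹ := by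
    have := hprod ha
    have := hprod hb
    rw [← C_mul, ← C_mul, ← C_mul]
    congr 1
    field_simp
  simp only [cons_val_zero, cons_val_one, Function.comp_apply] at hJ ⊢
  have e (c : ℕ) : (hermiteP ∘ fun _ : Fin 1 => c) = fun _ => hermiteP c := rfl
  simp only [e]
  linear_combination (wronskianDet (hermiteP ∘ v) *
    wronskianDet (Fin.append (hermiteP ∘ v) (hermiteP ∘ ![a, b]))) * hc +
    C (vander v * ∏ i, ((a : ℂ) - v i))⁻¹ * C (vander v * ∏ i, ((b : ℂ) - v i))⁻¹ * hJ

theorem crum_of_hirota {F a b t : ℂ[X]} {p q : ℂ} (hF : F ≠ 0) (hpq : p ≠ q)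
    (hJ : C (q - p) * F * t = a * derivative b - derivative a * b)
    (ha : hirotaBil p F a = 0) (hb : hirotaBil q F b = 0) :
    a * b = F * derivative t - derivative F * t + X * F * t := by
  have hd := congrArg derivative hJ
  simp only [derivative_sub, derivative_mul, derivative_C, zero_mul, zero_add] at hd
  have hc : C (q - p) * F ≠ 0 := mul_ne_zero (C_ne_zero.2 (sub_ne_zero.2 hpq.symm)) hF
  apply mul_left_cancel₀ hc
  rw [hirotaBil] at ha hb
  rw [C_sub] at *
  linear_combination b * ha - a * hb - F * hd + (2 * derivative F - X * F) * hJ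

theorem hirotaBil_of_crum {F a b t : ℂ[X]} {p q : ℂ} (hF : F ≠ 0)
    (hJ : C (q - p) * F * t = a * derivative b - derivative a * b)
    (ha : hirotaBil p F a = 0) (hB : a * b = F * derivative t - derivative F * t + X * F * t) :
    hirotaBil (q - 1) a t = 0 := by
  have hd := congrArg derivative hB
  simp only [derivative_sub, derivative_add, derivative_mul, derivative_X, one_mul] at hd
  apply mul_left_cancel₀ hF
  rw [hirotaBil] at *
  simp only [C_sub, C_1] at *
  linear_combination (-a) * hd - a * hJ + 2 * derivative a * hB + t * ha

theorem tau_ne_zero_and_hirotaBil (n : ℕ) :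
    ∀ S : Finset ℕ, S.card = n → tau S ≠ 0 ∧
      ∀ a ∉ S, tau (insert a S) ≠ 0 ∧ hirotaBil ((a : ℂ) - n) (tau S) (tau (insert a S)) = 0 := by
  induction n with
  | zero =>
    intro S hS
    rw [Finset.card_eq_zero] at hS
    subst hS
    refine ⟨by rw [tau_empty]; exact one_ne_zero, fun a _ => ?_⟩
    rw [insert_empty_eq, tau_singleton, tau_empty]
    refine ⟨hermiteP_ne_zero a, ?_⟩
    rw [hirotaBil]
    simp only [derivative_one, map_zero, Nat.cast_zero, sub_zero]
    linear_combination hermiteP_ode a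
  | succ n ih =>
    intro S hS
    obtain ⟨b, T, hbS, rfl, hT⟩ := Finset.card_eq_succ.1 hS
    obtain ⟨hS0, hS1⟩ := ih T hT
    refine ⟨(hS1 b hbS).1, fun a ha => ?_⟩
    have haS : a ∉ T := fun h => ha (Finset.mem_insert_of_mem h)
    have hba : b ≠ a := fun h => ha (h ▸ Finset.mem_insert_self b T)
    have hJ := tau_jacobi hS0 hbS haS hba
    have hJ' : C (((a : ℂ) - n) - (b - n)) * tau T * tau (insert a (insert b T)) =
        tau (insert b T) * derivative (tau (insert a T)) -
          derivative (tau (insert b T)) * tau (insert a T) := by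
      rw [sub_sub_sub_cancel_right]
      exact hJ
    have hne : (b : ℂ) - n ≠ a - n := fun h => hba (Nat.cast_injective (sub_left_injective h))
    have hB := crum_of_hirota hS0 hne hJ' (hS1 b hbS).2 (hS1 a haS).2
    refine ⟨fun h => ?_, ?_⟩
    · rw [h] at hB
      simp only [derivative_zero, mul_zero, sub_zero, add_zero] at hB
      exact mul_ne_zero (hS1 b hbS).1 (hS1 a haS).1 hB
    · have := hirotaBil_of_crum hS0 hJ' (hS1 b hbS).2 hB
      rwa [sub_sub, ← Nat.cast_succ] at this

theorem tau_ne_zero (S : Finset ℕ) : tau S ≠ 0 := (tau_ne_zero_and_hirotaBil _ S rfl).1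

theorem hirotaBil_tau_insert {S : Finset ℕ} {a : ℕ} (ha : a ∉ S) :
    hirotaBil ((a : ℂ) - S.card) (tau S) (tau (insert a S)) = 0 :=
  ((tau_ne_zero_and_hirotaBil _ S rfl).2 a ha).2

theorem tau_insert_mul_tau_insert {S : Finset ℕ} {a b : ℕ} (ha : a ∉ S) (hb : b ∉ S)
    (hab : a ≠ b) :
    tau (insert a S) * tau (insert b S) =
      tau S * derivative (tau (insert b (insert a S))) -
        derivative (tau S) * tau (insert b (insert a S)) +
        X * tau S * tau (insert b (insert a S)) := by
  refine crum_of_hirota (tau_ne_zero S) (p := (a : ℂ) - S.card) (q := (b : ℂ) - S.card) ?_ ?_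
    (hirotaBil_tau_insert ha) (hirotaBil_tau_insert hb)
  · exact fun h => hab (Nat.cast_injective (sub_left_injective h))
  · rw [sub_sub_sub_cancel_right]
    exact tau_jacobi (tau_ne_zero S) ha hb hab

theorem todaLHS_of_hirota {F G H P Q : ℂ[X]} {p q r s : ℂ} (hG : G ≠ 0) (hH : H ≠ 0)
    (h₀ : hirotaBil p F G = 0) (h₁ : hirotaBil q G H = 0) (h₂ : hirotaBil r H F = 0)
    (hP : H * P = G * derivative F - derivative G * F + X * G * F)
    (hQ : G * Q = F * derivative H - derivative F * H + X * F * H)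
    (hs : 2 * s = q - p - r) : todaLHS s F = P * Q := by
  have hc : (2 : ℂ[X]) * G * H ≠ 0 := mul_ne_zero (mul_ne_zero two_ne_zero hG) hH
  apply mul_left_cancel₀ hc
  have hs' : 2 * C s = C q - C p - C r := by
    rw [← C_sub, ← C_sub, ← hs, C_mul]
    rfl
  rw [hirotaBil] at *
  rw [todaLHS]
  linear_combination F * H * h₀ + F * G * h₂ - F ^ 2 * h₁ + F ^ 2 * G * H * hs' -
    2 * G * Q * hP - 2 * (G * derivative F - derivative G * F + X * G * F) * hQ

theorem todaLHS_tau {S : Finset ℕ} {a b c d : ℕ} (ha : a ∉ S) (hb : b ∉ S) (hc : c ∉ S)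
    (hd : d ∉ S) (hab : a ≠ b) (hac : a ≠ c) (had : a ≠ d) (hbc : b ≠ c) (hbd : b ≠ d)
    (hcd : c ≠ d)
    (h₁ : tau (insert a (insert c (insert b S))) = tau S)
    (h₂ : tau (insert d (insert a (insert c (insert b S)))) = tau (insert b S))
    {s : ℂ} (hs : 2 * s = b - a - c + S.card + 3) :
    todaLHS s (tau (insert c (insert b S))) =
      tau (insert c S) * tau (insert d (insert c (insert b S))) := by
  have hc' : c ∉ insert b S := by simp [hc, hbc.symm]
  have ha' : a ∉ insert c (insert b S) := by simp [ha, hab, hac]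
  have hd' : d ∉ insert c (insert b S) := by simp [hd, hbd.symm, hcd.symm]
  have e₀ := hirotaBil_tau_insert ha'
  have e₁ := hirotaBil_tau_insert hb
  have e₂ := hirotaBil_tau_insert hc'
  have eP := tau_insert_mul_tau_insert hb hc hbc
  have eQ := tau_insert_mul_tau_insert ha' hd' had
  rw [h₁] at e₀ eQ
  rw [h₂] at eQ
  refine todaLHS_of_hirota (tau_ne_zero S) (tau_ne_zero (insert b S)) e₀ e₁ e₂ eP eQ ?_
  rw [hs, Finset.card_insert_of_notMem hc', Finset.card_insert_of_notMem hb]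
  push_cast
  ring

theorem wronskianDet_hermiteP_cons_zero {n : ℕ} (v : Fin n → ℕ) :
    wronskianDet (hermiteP ∘ (Fin.cons 0 (Nat.succ ∘ v) : Fin (n + 1) → ℕ)) =
      C (∏ i, ((v i : ℂ) + 1)) * wronskianDet (hermiteP ∘ v) := by
  rw [wronskianDet, det_succ_row_zero, Fin.sum_univ_succ, Finset.sum_eq_zero]
  · rw [add_zero, wronskianDet, map_prod, ← det_mul_column]
    simp only [Fin.val_zero, pow_zero, one_mul, of_apply, Function.comp_apply, Fin.cons_zero,
      hermiteP_zero, Function.iterate_zero, id]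
    refine congrArg det (Matrix.ext fun i j => ?_)
    simp [derivative_hermiteP_succ, -map_add, -map_natCast]
  · intro j _
    simp [hermiteP_zero]

theorem vander_cons_zero {n : ℕ} (v : Fin n → ℕ) :
    vander (Fin.cons 0 (Nat.succ ∘ v) : Fin (n + 1) → ℕ) =
      (∏ i, ((v i : ℂ) + 1)) * vander v := by
  simp [vander, det_vandermonde, Fin.prod_univ_succ, Fin.prod_Ioi_succ]

theorem tau_insert_zero (S : Finset ℕ) :
    tau (insert 0 (S.map (addRightEmbedding 1))) = tau S := by
  obtain ⟨v, hv⟩ : ∃ v : Fin S.card → ℕ, v = S.orderEmbOfFin rfl := ⟨_, rfl⟩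
  have hinj : Function.Injective v := hv ▸ (S.orderEmbOfFin rfl).injective
  have hmem (i) : v i ∈ S := hv ▸ S.orderEmbOfFin_mem rfl i
  have h0 : tau S = tauFn v := by rw [hv, tau]
  rw [h0, tau_eq_tauFn (v := Fin.cons 0 (Nat.succ ∘ v)) (n := S.card + 1), tauFn, tauFn,
    wronskianDet_hermiteP_cons_zero, vander_cons_zero, ← mul_assoc, ← C_mul]
  · congr 2
    have h1 : ∏ i, ((v i : ℂ) + 1) ≠ 0 :=
      Finset.prod_ne_zero_iff.2 fun i _ => Nat.cast_add_one_ne_zero _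
    have := vander_ne_zero hinj
    field_simp
  · rw [Finset.card_insert_of_notMem (by simp), Finset.card_map]
  · rw [Fin.cons_injective_iff]
    exact ⟨by simp, Nat.succ_injective.comp hinj⟩
  · intro i
    refine Fin.cases (by simp) (fun i => ?_) i
    simp [hmem]

/-- The Maya diagram with all negative positions and the finite set `S` filled. -/
def filledMaya (S : Finset ℕ) : Set ℤ := {z | z < 0 ∨ ∃ s ∈ S, (s : ℤ) = z}

theorem tau_eq_of_filledMaya_add_nat (d : ℕ) : ∀ {S T : Finset ℕ},
    (∀ z : ℤ, z ∈ filledMaya S ↔ z + d ∈ filledMaya T) → tau S = tau T := by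
  induction d with
  | zero =>
    intro S T h
    congr 1
    ext n
    simpa [filledMaya, (Int.natCast_nonneg n).not_gt] using h n
  | succ d ih =>
    intro S T h
    simp only [filledMaya, Set.mem_ofPred_eq] at h
    have h0 : 0 ∈ T := by
      obtain h | ⟨s, hs, h⟩ := (h (-(d + 1))).1 (Or.inl (by lia))
      · push_cast at h
        lia
      · obtain rfl : s = 0 := by push_cast at h; lia
        exact hs
    obtain ⟨U, rfl⟩ : ∃ U : Finset ℕ, T = insert 0 (U.map (addRightEmbedding 1)) := by
      refine ⟨(T.erase 0).image Nat.pred, ?_⟩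
      ext n
      cases n with
      | zero => simp [h0]
      | succ n =>
        simp only [Finset.mem_insert, Finset.mem_map, Finset.mem_image, Finset.mem_erase,
          addRightEmbedding_apply]
        constructor
        · exact fun hn => Or.inr ⟨n, ⟨n + 1, ⟨by lia, hn⟩, rfl⟩, rfl⟩
        · rintro (h | ⟨a, ⟨b, ⟨hb, hbT⟩, rfl⟩, hn⟩)
          · lia
          · obtain rfl : b = n + 1 := by rw [Nat.pred_eq_sub_one] at hn; lia
            exact hbT
    rw [tau_insert_zero]
    refine ih fun z => ?_
    rw [filledMaya, filledMaya, Set.mem_ofPred_eq, Set.mem_ofPred_eq, h]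
    simp only [Finset.mem_insert, Finset.mem_map, addRightEmbedding_apply]
    constructor
    · rintro (h | ⟨s, rfl | ⟨a, ha, rfl⟩, hz⟩)
      · left; push_cast at h; lia
      · left; push_cast at hz; lia
      · right; exact ⟨a, ha, by push_cast at hz; lia⟩
    · rintro (h | ⟨a, ha, hz⟩)
      · rcases eq_or_ne (z + d) (-1) with h' | h'
        · right; exact ⟨0, Or.inl rfl, by push_cast; lia⟩
        · left; push_cast; lia
      · right; exact ⟨a + 1, Or.inr ⟨a, ha, rfl⟩, by push_cast; lia⟩

theorem tau_eq_of_filledMaya {S T : Finset ℕ} (d : ℤ)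
    (h : ∀ z : ℤ, z ∈ filledMaya S ↔ z + d ∈ filledMaya T) : tau S = tau T := by
  obtain ⟨n, rfl | rfl⟩ := d.eq_nat_or_neg
  · exact tau_eq_of_filledMaya_add_nat n h
  · refine (tau_eq_of_filledMaya_add_nat n fun z => ?_).symm
    rw [h, add_neg_cancel_right]

theorem lt_conjPart_iff {lam : ℕ → ℕ} (hlam : Antitone lam) {ℓ k : ℕ} (hk : k < ℓ) (j : ℕ) :
    k < conjPart ℓ lam j ↔ j < lam k := by
  rw [conjPart]
  refine ⟨fun h => ?_, fun h => ?_⟩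
  · by_contra! h'
    refine h.not_ge ((Finset.card_le_card fun i hi => ?_).trans_eq (Finset.card_range k))
    rw [Finset.mem_filter] at hi
    rw [Finset.mem_range]
    by_contra! hki
    have := hlam hki
    lia
  · rw [Nat.lt_iff_add_one_le, ← Finset.card_range (k + 1)]
    refine Finset.card_le_card fun i hi => ?_
    rw [Finset.mem_range] at hi
    rw [Finset.mem_filter, Finset.mem_range]
    have := hlam (Nat.lt_add_one_iff.1 hi)
    lia

theorem conjPart_antitone (ℓ : ℕ) (lam : ℕ → ℕ) : Antitone (conjPart ℓ lam) := fun j j' h =>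
  Finset.card_le_card (Finset.monotone_filter_right _ fun i _ (hi : j' + 1 ≤ lam i) =>
    (show j + 1 ≤ lam i by lia))

theorem prod_hook_mul_prod_sub {lam : ℕ → ℕ} (hlam : Antitone lam) {ℓ : ℕ} (i : Fin ℓ) :
    (∏ j ∈ Finset.range (lam i), (lam i - j + conjPart ℓ lam j - i - 1)) *
      ∏ k ∈ Finset.Ioi i, ((lam i + i.rev) - (lam k + k.rev)) =
        Nat.factorial (lam i + i.rev) := by
  have hrev (k : Fin ℓ) : (k.rev : ℕ) = ℓ - (k + 1) := Fin.val_rev k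
  have hconj (k : Fin ℓ) (j : ℕ) : (k : ℕ) < conjPart ℓ lam j ↔ j < lam k :=
    lt_conjPart_iff hlam k.2 j
  have hi := i.2
  let f : ℕ → ℕ := fun j => lam i - j + conjPart ℓ lam j - i - 1
  let g : Fin ℓ → ℕ := fun k => (lam i + i.rev) - (lam k + k.rev)
  have hinj₁ : Set.InjOn f (Finset.range (lam i)) := by
    refine StrictAntiOn.injOn fun j _ j' hj' h => ?_
    have := conjPart_antitone ℓ lam h.le
    have hj'' := Finset.mem_range.1 hj'
    have := (hconj i j').2 hj''
    simp only [f]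
    lia
  have hinj₂ : Set.InjOn g (Finset.Ioi i) := by
    refine StrictMonoOn.injOn fun k hk k' _ h => ?_
    have hik := Finset.mem_Ioi.1 hk
    have := hlam hik.le
    have := hlam h.le
    have := k'.2
    simp only [g, hrev]
    lia
  change (∏ j ∈ Finset.range (lam i), f j) * ∏ k ∈ Finset.Ioi i, g k = _
  have hdisj : Disjoint ((Finset.range (lam i)).image f) ((Finset.Ioi i).image g) := by
    rw [Finset.disjoint_left]
    intro x hx hx'
    rw [Finset.mem_image] at hx hx'
    obtain ⟨j, hj, rfl⟩ := hx
    obtain ⟨k, hk, hkj⟩ := hx'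
    rw [Finset.mem_range] at hj
    rw [Finset.mem_Ioi] at hk
    have := hlam hk.le
    have := k.2
    have := hconj k j
    have := (hconj i j).2 hj
    simp only [f, g, hrev] at hkj
    lia
  rw [← Finset.prod_image (f := fun x => x) hinj₁, ← Finset.prod_image (f := fun x => x) hinj₂,
    ← Finset.prod_union hdisj, ← Finset.prod_Ico_id_eq_factorial]
  refine Finset.prod_congr (Finset.eq_of_subset_of_card_le ?_ ?_) fun _ _ => rfl
  · intro x hx
    rw [Finset.mem_union, Finset.mem_image, Finset.mem_image] at hx
    rw [Finset.mem_Ico]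
    obtain ⟨j, hj, rfl⟩ | ⟨k, hk, rfl⟩ := hx
    · rw [Finset.mem_range] at hj
      have := (hconj i j).2 hj
      have : conjPart ℓ lam j ≤ ℓ :=
        (Finset.card_filter_le _ _).trans_eq (Finset.card_range ℓ)
      rw [hrev]
      lia
    · rw [Finset.mem_Ioi] at hk
      have := hlam hk.le
      have := k.2
      simp only [g, hrev]
      lia
  · rw [Finset.card_union_of_disjoint hdisj, Finset.card_image_of_injOn hinj₁,
      Finset.card_image_of_injOn hinj₂, Finset.card_range, Fin.card_Ioi, Nat.card_Ico, hrev]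
    lia

theorem hookProd_mul_prod_sub {lam : ℕ → ℕ} (hlam : Antitone lam) (ℓ : ℕ) :
    (hookProd ℓ lam : ℂ) * vander (fun i : Fin ℓ => lam i.rev + i) =
      ∏ i : Fin ℓ, (Nat.factorial (lam i + i.rev) : ℂ) := by
  have h : vander (fun i : Fin ℓ => lam i.rev + i) =
      ∏ i : Fin ℓ, ∏ k ∈ Finset.Ioi i, (((lam i + i.rev) - (lam k + k.rev) : ℕ) : ℂ) := by
    rw [vander, det_vandermonde, Finset.prod_sigma', Finset.prod_sigma']
    refine Finset.prod_nbij' (fun p => ⟨p.2.rev, p.1.rev⟩) (fun p => ⟨p.2.rev, p.1.rev⟩)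
      (by simp) (by simp) (by simp) (by simp) ?_
    rintro ⟨i, j⟩ hij
    simp only [Finset.mem_sigma, Finset.mem_univ, true_and, Finset.mem_Ioi] at hij
    have := hlam (Fin.rev_lt_rev.2 hij).le
    simp only [Fin.rev_rev]
    rw [Nat.cast_sub (by lia)]
  rw [h, hookProd, Finset.prod_range, Nat.cast_prod, ← Finset.prod_mul_distrib]
  refine Finset.prod_congr rfl fun i _ => ?_
  rw [← Nat.cast_prod, ← Nat.cast_mul, prod_hook_mul_prod_sub hlam]

theorem wronskianDet_hermiteP_eq_jacobiTrudi (lam : ℕ → ℕ) (ℓ : ℕ) :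
    wronskianDet (hermiteP ∘ fun i : Fin ℓ => lam i.rev + i) =
      C (∏ i : Fin ℓ, (Nat.factorial (lam i + i.rev) : ℂ)) * jacobiTrudi (1 / 2) ℓ lam := by
  rw [wronskianDet, jacobiTrudi, map_prod, ← det_mul_column,
    ← det_submatrix_equiv_self Fin.revPerm]
  refine congrArg det (Matrix.ext fun i j => ?_)
  simp only [submatrix_apply, of_apply, Function.comp_apply, Fin.revPerm_apply, Fin.rev_rev,
    iterate_derivative_hermiteP]
  congr 2
  simp only [Fin.val_rev]
  have := i.2
  have := j.2
  lia

theorem strictMono_rev_add {lam : ℕ → ℕ} (hlam : Antitone lam) (ℓ : ℕ) :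
    StrictMono fun i : Fin ℓ => lam i.rev + i := fun _ _ h =>
  add_lt_add_of_le_of_lt (hlam (Fin.rev_lt_rev.2 h).le) h

theorem hookProd_mul_jacobiTrudi {lam : ℕ → ℕ} (hlam : Antitone lam) (ℓ : ℕ) :
    C (hookProd ℓ lam : ℂ) * jacobiTrudi (1 / 2) ℓ lam =
      tauFn fun i : Fin ℓ => lam i.rev + i := by
  have hinj := (strictMono_rev_add hlam ℓ).injective
  have := vander_ne_zero hinj
  rw [tauFn, wronskianDet_hermiteP_eq_jacobiTrudi, ← hookProd_mul_prod_sub hlam, ← mul_assoc,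
    ← C_mul]
  congr 2
  field_simp

theorem mem_mayaSet {m n z : ℤ} :
    z ∈ mayaSet m n ↔
      z % 3 = 0 ∧ z < 3 * m ∨ z % 3 = 1 ∧ z < 3 * n ∨ z % 3 = 2 ∧ z < 0 := by
  simp only [mayaSet, Set.mem_union, Set.mem_ofPred_eq]
  constructor
  · rintro ((⟨k, hk, rfl⟩ | ⟨k, hk, rfl⟩) | ⟨k, hk, rfl⟩) <;> lia
  · rintro (h | h | h)
    · exact Or.inl (Or.inl ⟨z / 3, by lia, by lia⟩)
    · exact Or.inl (Or.inr ⟨z / 3, by lia, by lia⟩)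
    · exact Or.inr ⟨z / 3, by lia, by lia⟩

theorem IsOkamotoQ.exists_eq_tau {m n : ℤ} {Q : ℂ[X]} (h : IsOkamotoQ m n Q) :
    ∃ (S : Finset ℕ) (d : ℤ), Q = tau S ∧ ∀ z, z ∈ mayaSet m n ↔ z + d ∈ filledMaya S := by
  obtain ⟨lam, c, ℓ, ⟨hlam, -, hM⟩, hℓ, rfl⟩ := h
  have hinj := (strictMono_rev_add hlam ℓ).injective
  refine ⟨Finset.univ.image fun i : Fin ℓ => lam i.rev + i, ℓ - c, ?_, fun z => ?_⟩
  · rw [hookProd_mul_jacobiTrudi hlam]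
    refine (tau_eq_tauFn ?_ hinj fun i => Finset.mem_image_of_mem _ (Finset.mem_univ i)).symm
    rw [Finset.card_image_of_injective _ hinj, Finset.card_univ, Fintype.card_fin]
  · rw [← hM, filledMaya]
    simp only [Set.mem_range, Set.mem_ofPred_eq, Finset.mem_image, Finset.mem_univ, true_and]
    constructor
    · rintro ⟨i, rfl⟩
      rcases lt_or_ge i ℓ with hi | hi
      · refine Or.inr ⟨_, ⟨Fin.rev ⟨i, hi⟩, rfl⟩, ?_⟩
        rw [Fin.rev_rev, Fin.val_rev]
        push_cast
        lia
      · have := hℓ i hi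
        left
        lia
    · rintro (hz | ⟨_, ⟨i, rfl⟩, hz⟩)
      · obtain ⟨i, hi⟩ := Int.eq_ofNat_of_zero_le (show 0 ≤ c - 1 - z by lia)
        refine ⟨i, ?_⟩
        have := hℓ i (by lia)
        lia
      · refine ⟨i.rev, ?_⟩
        have := i.2
        rw [Fin.val_rev] at hz ⊢
        push_cast at hz
        lia

theorem IsOkamotoQ.eq_tau_of_filledMaya {m n : ℤ} {Q : ℂ[X]} (h : IsOkamotoQ m n Q)
    (S : Finset ℕ) (d : ℤ) (hS : ∀ z, z ∈ mayaSet m n ↔ z + d ∈ filledMaya S) : Q = tau S := by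
  obtain ⟨T, e, rfl, hT⟩ := h.exists_eq_tau
  refine (tau_eq_of_filledMaya (e - d) fun z => ?_).symm
  rw [← add_sub_assoc, add_sub_right_comm, ← hT, hS, sub_add_cancel]

/-- The first `p`, `q`, `r` natural numbers in the residue classes `0`, `1`, `2` modulo `3`. -/
def residueFinset (p q r : ℕ) : Finset ℕ :=
  (Finset.range (3 * (p + q + r))).filter fun k =>
    k % 3 = 0 ∧ k < 3 * p ∨ k % 3 = 1 ∧ k < 3 * q ∨ k % 3 = 2 ∧ k < 3 * r

theorem mem_residueFinset {p q r k : ℕ} :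
    k ∈ residueFinset p q r ↔
      k % 3 = 0 ∧ k < 3 * p ∨ k % 3 = 1 ∧ k < 3 * q ∨ k % 3 = 2 ∧ k < 3 * r := by
  rw [residueFinset, Finset.mem_filter, Finset.mem_range]
  lia

theorem residueFinset_succ_left (p q r : ℕ) :
    residueFinset (p + 1) q r = insert (3 * p) (residueFinset p q r) := by
  ext k
  rw [Finset.mem_insert, mem_residueFinset, mem_residueFinset]
  lia

theorem residueFinset_succ_middle (p q r : ℕ) :
    residueFinset p (q + 1) r = insert (3 * q + 1) (residueFinset p q r) := by
  ext k
  rw [Finset.mem_insert, mem_residueFinset, mem_residueFinset]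
  lia

theorem residueFinset_succ_right (p q r : ℕ) :
    residueFinset p q (r + 1) = insert (3 * r + 2) (residueFinset p q r) := by
  ext k
  rw [Finset.mem_insert, mem_residueFinset, mem_residueFinset]
  lia

theorem card_residueFinset (p q r : ℕ) : (residueFinset p q r).card = p + q + r := by
  induction p with
  | succ p ih =>
    rw [residueFinset_succ_left, Finset.card_insert_of_notMem, ih]
    · lia
    · rw [mem_residueFinset]
      lia
  | zero =>
    induction q with
    | succ q ih =>
      rw [residueFinset_succ_middle, Finset.card_insert_of_notMem, ih]
      · lia
      · rw [mem_residueFinset]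
        lia
    | zero =>
      induction r with
      | succ r ih =>
        rw [residueFinset_succ_right, Finset.card_insert_of_notMem, ih]
        · lia
        · rw [mem_residueFinset]
          lia
      | zero => rfl

theorem mem_filledMaya_residueFinset {p q r : ℕ} {z : ℤ} :
    z ∈ filledMaya (residueFinset p q r) ↔
      z % 3 = 0 ∧ z < 3 * p ∨ z % 3 = 1 ∧ z < 3 * q ∨ z % 3 = 2 ∧ z < 3 * r := by
  simp only [filledMaya, Set.mem_ofPred_eq, mem_residueFinset]
  constructor
  · rintro (h | ⟨s, h, rfl⟩) <;> lia
  · intro h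
    rcases lt_or_ge z 0 with hz | hz
    · exact Or.inl hz
    · exact Or.inr ⟨z.toNat, by lia, by lia⟩

theorem tau_residueFinset_succ (p q r : ℕ) :
    tau (residueFinset (p + 1) (q + 1) (r + 1)) = tau (residueFinset p q r) := by
  refine (tau_eq_of_filledMaya 3 fun z => ?_).symm
  rw [mem_filledMaya_residueFinset, mem_filledMaya_residueFinset]
  push_cast
  lia

theorem IsOkamotoQ.eq_tau {m n : ℤ} {Q : ℂ[X]} (h : IsOkamotoQ m n Q) {p q r : ℕ}
    (hm : m + r = p) (hn : n + r = q) : Q = tau (residueFinset p q r) := by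
  refine h.eq_tau_of_filledMaya _ (3 * r) fun z => ?_
  rw [mem_mayaSet, mem_filledMaya_residueFinset]
  lia

theorem todaLHS_tau_residueFinset_left (p q r : ℕ) :
    todaLHS (2 * p - q - r) (tau (residueFinset (p + 1) q (r + 1))) =
      tau (residueFinset p q (r + 1)) * tau (residueFinset (p + 2) q (r + 1)) := by
  have h := todaLHS_tau (S := residueFinset p q r) (a := 3 * q + 1) (b := 3 * p)
    (c := 3 * r + 2) (d := 3 * (p + 1)) (s := 2 * p - q - r)
  simp only [← residueFinset_succ_left, ← residueFinset_succ_middle,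
    ← residueFinset_succ_right] at h
  refine h ?_ ?_ ?_ ?_ (by lia) (by lia) (by lia) (by lia) (by lia) (by lia)
    (tau_residueFinset_succ p q r) (tau_residueFinset_succ (p + 1) q r) ?_
  iterate 4 rw [mem_residueFinset]; lia
  rw [card_residueFinset]
  push_cast
  ring

theorem todaLHS_tau_residueFinset_middle (p q r : ℕ) :
    todaLHS (2 * q - p - r + 1) (tau (residueFinset p (q + 1) (r + 1))) =
      tau (residueFinset p q (r + 1)) * tau (residueFinset p (q + 2) (r + 1)) := by
  have h := todaLHS_tau (S := residueFinset p q r) (a := 3 * p) (b := 3 * q + 1)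
    (c := 3 * r + 2) (d := 3 * (q + 1) + 1) (s := 2 * q - p - r + 1)
  simp only [← residueFinset_succ_left, ← residueFinset_succ_middle,
    ← residueFinset_succ_right] at h
  refine h ?_ ?_ ?_ ?_ (by lia) (by lia) (by lia) (by lia) (by lia) (by lia)
    (tau_residueFinset_succ p q r) (tau_residueFinset_succ p (q + 1) r) ?_
  iterate 4 rw [mem_residueFinset]; lia
  rw [card_residueFinset]
  push_cast
  ring

theorem todaLHS_tau_residueFinset_right (p q r : ℕ) :
    todaLHS (2 * r - p - q + 2) (tau (residueFinset p (q + 1) (r + 1))) =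
      tau (residueFinset p (q + 1) r) * tau (residueFinset p (q + 1) (r + 2)) := by
  have h := todaLHS_tau (S := residueFinset p q r) (a := 3 * p) (b := 3 * r + 2)
    (c := 3 * q + 1) (d := 3 * (r + 1) + 2) (s := 2 * r - p - q + 2)
  simp only [← residueFinset_succ_left, ← residueFinset_succ_middle,
    ← residueFinset_succ_right] at h
  refine h ?_ ?_ ?_ ?_ (by lia) (by lia) (by lia) (by lia) (by lia) (by lia)
    (tau_residueFinset_succ p q r) (tau_residueFinset_succ p q (r + 1)) ?_
  iterate 4 rw [mem_residueFinset]; lia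
  rw [card_residueFinset]
  push_cast
  ring

end

/-- **Initial conditions and Toda equations for the Okamoto polynomials:**
`Q_{0,0} = Q_{1,0} = Q_{1,1} = 1`, `Q_{2,1} = x`, and for all `m, n ∈ ℤ` the three
Toda equations hold:
`Q''Q − Q'² + (x² − 1 + 2m − n)Q² = Q_{m+1,n}Q_{m−1,n}`,
`Q''Q − Q'² + (x² − m + 2n)Q² = Q_{m,n+1}Q_{m,n−1}`,
`Q''Q − Q'² + (x² + 1 − m − n)Q² = Q_{m−1,n−1}Q_{m+1,n+1}`. -/
theorem okamoto_polynomials_toda :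
    (∀ Q : Polynomial ℂ, IsOkamotoQ 0 0 Q → Q = 1) ∧
    (∀ Q : Polynomial ℂ, IsOkamotoQ 1 0 Q → Q = 1) ∧
    (∀ Q : Polynomial ℂ, IsOkamotoQ 1 1 Q → Q = 1) ∧
    (∀ Q : Polynomial ℂ, IsOkamotoQ 2 1 Q → Q = Polynomial.X) ∧
    (∀ (m n : ℤ) (Q Qa Qb Qc Qd Qe Qf : Polynomial ℂ),
      IsOkamotoQ m n Q →
      IsOkamotoQ (m + 1) n Qa → IsOkamotoQ (m - 1) n Qb →
      IsOkamotoQ m (n + 1) Qc → IsOkamotoQ m (n - 1) Qd →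
      IsOkamotoQ (m - 1) (n - 1) Qe → IsOkamotoQ (m + 1) (n + 1) Qf →
      todaLHS (((-1 + 2 * m - n : ℤ) : ℂ)) Q = Qa * Qb ∧
      todaLHS (((-m + 2 * n : ℤ) : ℂ)) Q = Qc * Qd ∧
      todaLHS (((1 - m - n : ℤ) : ℂ)) Q = Qe * Qf) := by
  refine ⟨fun Q h => ?_, fun Q h => ?_, fun Q h => ?_, fun Q h => ?_, ?_⟩
  · rw [h.eq_tau_of_filledMaya ∅ 0, tau_empty]
    intro z
    simp only [mem_mayaSet, filledMaya, Set.mem_ofPred_eq, Finset.notMem_empty, false_and,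
      exists_false, or_false]
    lia
  · rw [h.eq_tau_of_filledMaya ∅ (-1), tau_empty]
    intro z
    simp only [mem_mayaSet, filledMaya, Set.mem_ofPred_eq, Finset.notMem_empty, false_and,
      exists_false, or_false]
    lia
  · rw [h.eq_tau_of_filledMaya ∅ (-2), tau_empty]
    intro z
    simp only [mem_mayaSet, filledMaya, Set.mem_ofPred_eq, Finset.notMem_empty, false_and,
      exists_false, or_false]
    lia
  · rw [h.eq_tau_of_filledMaya {1} (-2), tau_singleton]
    · simp [hermiteP, p2]
    intro z
    simp only [mem_mayaSet, filledMaya, Set.mem_ofPred_eq, Finset.mem_singleton, exists_eq_left]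
    lia
  · intro m n Q Qa Qb Qc Qd Qe Qf h ha hb hc hd he hf
    obtain ⟨r, hr⟩ : ∃ r : ℕ, r = m.natAbs + n.natAbs + 1 := ⟨_, rfl⟩
    obtain ⟨p, hp⟩ : ∃ p : ℕ, m + r = p := Int.eq_ofNat_of_zero_le (by lia)
    obtain ⟨q, hq⟩ : ∃ q : ℕ, n + r = q := Int.eq_ofNat_of_zero_le (by lia)
    have hp' : (m : ℂ) = p - r := by rw [eq_sub_iff_add_eq]; exact_mod_cast hp
    have hq' : (n : ℂ) = q - r := by rw [eq_sub_iff_add_eq]; exact_mod_cast hq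
    refine ⟨?_, ?_, ?_⟩
    · rw [h.eq_tau (p := p + 1) (q := q + 1) (r := r + 1) (by lia) (by lia),
        ha.eq_tau (p := p + 2) (q := q + 1) (r := r + 1) (by lia) (by lia),
        hb.eq_tau (p := p) (q := q + 1) (r := r + 1) (by lia) (by lia), mul_comm (tau _),
        ← todaLHS_tau_residueFinset_left p (q + 1) r]
      congr 1
      push_cast
      linear_combination 2 * hp' - hq'
    · rw [h.eq_tau (p := p + 1) (q := q + 1) (r := r + 1) (by lia) (by lia),
        hc.eq_tau (p := p + 1) (q := q + 2) (r := r + 1) (by lia) (by lia),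
        hd.eq_tau (p := p + 1) (q := q) (r := r + 1) (by lia) (by lia), mul_comm (tau _),
        ← todaLHS_tau_residueFinset_middle (p + 1) q r]
      congr 1
      push_cast
      linear_combination 2 * hq' - hp'
    · rw [h.eq_tau (p := p + 1) (q := q + 1) (r := r + 1) (by lia) (by lia),
        he.eq_tau (p := p + 1) (q := q + 1) (r := r + 2) (by lia) (by lia),
        hf.eq_tau (p := p + 1) (q := q + 1) (r := r) (by lia) (by lia), mul_comm (tau _),
        ← todaLHS_tau_residueFinset_right (p + 1) q r]
      congr 1
      push_cast
      linear_combination -hp' - hq'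
end

section
/- For all integers m, n ≥ 0, the polynomials h_{m,n}(x) = S_{(n^m)}(x, 1/6) satisfy the three Hirota bilinear equations: (D_x² − 3x·D_x + 3m) h_{m,n+1}·h_{m,n} = 0; (D_x² − 3x·D_x + 3(m − n)) h_{m,n+1}·h_{m+1,n} = 0; and (D_x² − 3x·D_x − 3n) h_{m,n}·h_{m+1,n} = 0, where (D_x² − 3x·D_x + c) F·G = F''G − 2F'G' + FG'' − 3x(F'G − FG') + c·FG. -/
/-- `hRect m n` is the polynomial `h_{m,n}(x) = S_{(nᵐ)}(x, 1/6)`: the Jacobi–Trudi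
determinant `det(p_{n−i+j}(x, 1/6))_{1≤i,j≤m}` of the rectangular partition `(nᵐ)`
with `m` parts equal to `n`. -/
noncomputable def hRect (m n : ℕ) : Polynomial ℂ :=
  Matrix.det (Matrix.of fun i j : Fin m =>
    p2Z (1 / 6) ((n : ℤ) - (i : ℕ) + (j : ℕ)))

/-- The Hirota bilinear expression `(Dₓ² − 3x·Dₓ + c) F·G` for polynomials. -/
noncomputable def hirota3 (c : ℂ) (F G : Polynomial ℂ) : Polynomial ℂ :=
  Polynomial.derivative (Polynomial.derivative F) * G -
    2 * Polynomial.derivative F * Polynomial.derivative G +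
    F * Polynomial.derivative (Polynomial.derivative G) -
    3 * Polynomial.X * (Polynomial.derivative F * G - F * Polynomial.derivative G) +
    Polynomial.C c * (F * G)

open Polynomial in
theorem coeff_p2 (c : ℂ) (n i : ℕ) :
    (p2 c n).coeff i = ∑ j ∈ Finset.range (n / 2 + 1),
      if i = n - 2 * j then c ^ j / ((n - 2 * j).factorial * j.factorial : ℂ) else 0 := by
  simp [p2, coeff_C_mul, coeff_X_pow]

theorem coeff_p2Z_add_two_mul (c : ℂ) (i j : ℕ) :
    (p2Z c ((i : ℤ) + 2 * j)).coeff i = c ^ j / (i.factorial * j.factorial : ℂ) := by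
  have h : ((i : ℤ) + 2 * j).toNat = i + 2 * j := by omega
  rw [p2Z, if_pos (by positivity), h, coeff_p2, Finset.sum_eq_single j]
  · simp
  · intro b hb hbj
    rw [Finset.mem_range] at hb
    exact if_neg (by omega)
  · intro hj
    rw [Finset.mem_range] at hj
    omega

theorem coeff_p2Z_eq_zero (c : ℂ) (m : ℤ) (i : ℕ) (h : ∀ j : ℕ, m ≠ i + 2 * j) :
    (p2Z c m).coeff i = 0 := by
  rw [p2Z]
  split_ifs with hm
  · rw [coeff_p2]
    refine Finset.sum_eq_zero fun j hj => if_neg fun hi => h j ?_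
    rw [Finset.mem_range] at hj
    omega
  · simp

theorem derivative_p2Z (c : ℂ) (m : ℤ) :
    Polynomial.derivative (p2Z c m) = p2Z c (m - 1) := by
  ext i
  rw [Polynomial.coeff_derivative]
  by_cases h : ∃ j : ℕ, m = (i + 1 : ℕ) + 2 * j
  · obtain ⟨j, rfl⟩ := h
    have h1 : ((i + 1 : ℕ) : ℤ) + 2 * j - 1 = i + 2 * j := by push_cast; ring
    rw [h1, coeff_p2Z_add_two_mul, coeff_p2Z_add_two_mul, Nat.factorial_succ]
    have := Nat.cast_ne_zero (R := ℂ).2 i.factorial_ne_zero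
    have := Nat.cast_ne_zero (R := ℂ).2 j.factorial_ne_zero
    have := Nat.cast_add_one_ne_zero (R := ℂ) i
    push_cast
    field_simp
  · push Not at h
    rw [coeff_p2Z_eq_zero c m _ h, coeff_p2Z_eq_zero, zero_mul]
    intro j hj
    exact h j (by push_cast; linarith)

/-- Euler's homogeneity relation for `p_m(x, c)`, written with `∂₂ p_m = p_{m-2} = ∂₁² p_m`. -/
theorem p2Z_euler (c : ℂ) (m : ℤ) :
    Polynomial.C (m : ℂ) * p2Z c m =
      Polynomial.X * Polynomial.derivative (p2Z c m) + Polynomial.C (2 * c) * p2Z c (m - 2) := by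
  have hX (f : Polynomial ℂ) (i : ℕ) :
      (Polynomial.X * Polynomial.derivative f).coeff i = i * f.coeff i := by
    cases i with
    | zero => simp
    | succ i => rw [Polynomial.coeff_X_mul, Polynomial.coeff_derivative]; push_cast; ring
  ext i
  rw [Polynomial.coeff_add, Polynomial.coeff_C_mul, Polynomial.coeff_C_mul, hX]
  by_cases h : ∃ j : ℕ, m = i + 2 * j
  · obtain ⟨j, rfl⟩ := h
    cases j with
    | zero =>
      rw [coeff_p2Z_eq_zero c (_ - 2) _ (by intro j; push_cast; omega)]
      push_cast
      ring
    | succ j =>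
      have h1 : (i : ℤ) + 2 * (j + 1 : ℕ) - 2 = i + 2 * j := by push_cast; ring
      rw [h1, coeff_p2Z_add_two_mul, coeff_p2Z_add_two_mul, Nat.factorial_succ]
      have := Nat.cast_ne_zero (R := ℂ).2 i.factorial_ne_zero
      have := Nat.cast_ne_zero (R := ℂ).2 j.factorial_ne_zero
      have := Nat.cast_add_one_ne_zero (R := ℂ) j
      push_cast
      field_simp
      ring
  · push Not at h
    rw [coeff_p2Z_eq_zero c m _ h, coeff_p2Z_eq_zero]
    · simp
    · intro j hj
      exact h (j + 1) (by push_cast; linarith)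

theorem derivative_derivative_p2Z (m : ℤ) :
    Polynomial.derivative (Polynomial.derivative (p2Z (1 / 6) m)) =
      Polynomial.C (3 * (m : ℂ)) * p2Z (1 / 6) m -
        3 * Polynomial.X * Polynomial.derivative (p2Z (1 / 6) m) := by
  have h := p2Z_euler (1 / 6) m
  have h3 : (3 : Polynomial ℂ) * Polynomial.C (2 * (1 / 6)) = 1 := by
    rw [← Polynomial.C_ofNat, ← Polynomial.C_mul]
    norm_num
  have h2 : Polynomial.C (3 * (m : ℂ)) = 3 * Polynomial.C (m : ℂ) := by
    rw [Polynomial.C_mul, Polynomial.C_ofNat]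
  rw [derivative_p2Z, derivative_p2Z, sub_sub, one_add_one_eq_two, h2]
  rw [derivative_p2Z] at h
  linear_combination -3 * h - p2Z (1 / 6) (m - 2) * h3

namespace Matrix

/-- Three-term Plücker relation. -/
theorem plucker_three_term {R : Type*} [CommRing R] {k : ℕ}
    (U W : Matrix (Fin (k + 2)) (Fin (k + 2)) R)
    (hUW : ∀ j : Fin (k + 1), W j.succ = U j.castSucc) (a : Fin (k + 2) → R) :
    (U.updateRow 0 a).det * W.det =
      (U.updateRow 0 (W 0)).det * (W.updateRow 0 a).det + U.det * (W.updateRow 1 a).det := by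
  have hc : W.det • a = ∑ j, (W.updateRow j a).det • W j := by
    have h := mulVec_cramer Wᵀ a
    rw [det_transpose] at h
    rw [← h]
    ext i
    simp [mulVec, dotProduct, cramer_transpose_apply, mul_comm]
  have hφ := congrArg (fun v => (U.updateRow 0 v).det) hc
  simp only [det_updateRow_smul] at hφ
  have hsum : (U.updateRow 0 (∑ j, (W.updateRow j a).det • W j)).det =
      ∑ j, (W.updateRow j a).det * (U.updateRow 0 (W j)).det := by
    have h := map_sum (detRowAlternating.toMultilinearMap.toLinearMap U 0)
      (fun j => (W.updateRow j a).det • W j) Finset.univ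
    simp only [map_smul, smul_eq_mul] at h
    exact h
  rw [hsum, Fin.sum_univ_succ, Fin.sum_univ_succ] at hφ
  have hzero (j : Fin k) : (U.updateRow 0 (W j.succ.succ)).det = 0 := by
    refine det_zero_of_row_eq (i := 0) (j := j.succ.castSucc) (by simp [Fin.ext_iff]) ?_
    rw [updateRow_self, updateRow_ne (by simp [Fin.ext_iff]), hUW]
  have h0 : U.updateRow 0 (W (Fin.succ 0)) = U := by
    rw [hUW]
    exact updateRow_eq_self U 0
  simp only [hzero, mul_zero, Finset.sum_const_zero, h0] at hφ
  rw [mul_comm, hφ, Fin.succ_zero_eq_one]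
  ring

theorem det_updateRow_apply_sum {R n : Type*} [CommRing R] [Fintype n] [DecidableEq n]
    (V : Matrix n n R) (L : R → R) :
    ∑ j, (V.updateRow j (fun i => L (V j i))).det =
      ∑ σ : Equiv.Perm n, Equiv.Perm.sign σ •
        ∑ j, L (V j (σ j)) * ∏ l ∈ Finset.univ.erase j, V l (σ l) := by
  simp_rw [← det_transpose (updateRow _ _ _), det_apply, Finset.smul_sum]
  rw [Finset.sum_comm]
  refine Finset.sum_congr rfl fun σ _ => Finset.sum_congr rfl fun j _ => ?_
  rw [← Finset.mul_prod_erase _ _ (Finset.mem_univ j), transpose_apply, updateRow_self]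
  congr 2
  refine Finset.prod_congr rfl fun l hl => ?_
  rw [transpose_apply, updateRow_ne (Finset.ne_of_mem_erase hl)]

theorem derivative_det {R n : Type*} [CommRing R] [Fintype n] [DecidableEq n]
    (V : Matrix n n (Polynomial R)) :
    Polynomial.derivative V.det =
      ∑ j, (V.updateRow j (fun i => Polynomial.derivative (V j i))).det := by
  rw [det_updateRow_apply_sum, ← det_transpose, det_apply, Polynomial.derivative_sum]
  refine Finset.sum_congr rfl fun σ _ => ?_
  simp only [transpose_apply, Units.smul_def, Polynomial.derivative_smul,
    Polynomial.derivative_prod_finset]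
  congr 1
  exact Finset.sum_congr rfl fun j _ => mul_comm _ _

theorem sum_det_updateRow_weight {R n : Type*} [CommRing R] [Fintype n] [DecidableEq n]
    (V : Matrix n n R) (a b : n → R) :
    ∑ j, (V.updateRow j (fun i => (a j - b i) * V j i)).det =
      (∑ j, a j - ∑ i, b i) * V.det := by
  simp_rw [← det_transpose (updateRow _ _ _)]
  rw [← det_transpose V]
  simp_rw [det_apply, Finset.mul_sum]
  rw [Finset.sum_comm]
  refine Finset.sum_congr rfl fun σ _ => ?_
  rw [← Finset.smul_sum, mul_smul_comm]
  congr 1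
  rw [← Equiv.sum_comp σ b, ← Finset.sum_sub_distrib, Finset.sum_mul]
  refine Finset.sum_congr rfl fun j _ => ?_
  rw [← Finset.mul_prod_erase _ _ (Finset.mem_univ j), transpose_apply, updateRow_self,
    ← Finset.mul_prod_erase _ (fun l => Vᵀ (σ l) l) (Finset.mem_univ j), transpose_apply, mul_assoc]
  congr 2
  refine Finset.prod_congr rfl fun l hl => ?_
  rw [transpose_apply, transpose_apply, updateRow_ne (Finset.ne_of_mem_erase hl)]

theorem det_updateRow_updateRow_self {R n : Type*} [CommRing R] [Fintype n] [DecidableEq n]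
    (V : Matrix n n R) {i j : n} (hij : i ≠ j) (v : n → R) :
    ((V.updateRow i v).updateRow j (V i)).det = -(V.updateRow j v).det := by
  have h : (V.updateRow i v).updateRow j (V i) =
      (V.updateRow j v).submatrix (Equiv.swap i j) id := by
    ext l c
    rw [submatrix_apply, id]
    by_cases hi : l = i
    · subst hi
      rw [Equiv.swap_apply_left, updateRow_self, updateRow_ne hij, updateRow_self]
    by_cases hj : l = j
    · subst hj
      rw [Equiv.swap_apply_right, updateRow_self, updateRow_ne hij]
    · rw [Equiv.swap_apply_of_ne_of_ne hi hj, updateRow_ne hj, updateRow_ne hi, updateRow_ne hj]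
  rw [h, det_permute, Equiv.Perm.sign_swap hij]
  simp

end Matrix

open Polynomial in
/-- If each row of `V` after the first differentiates to its predecessor or to zero, then only
differentiating the first row contributes to the derivative of `V.det`, and only the first
two rows contribute to second-order expressions. -/
theorem derivative_det_of_chain {R : Type*} [CommRing R] {k : ℕ}
    (V : Matrix (Fin (k + 2)) (Fin (k + 2)) R[X])
    (hV : ∀ j : Fin (k + 1), derivative ∘ V j.succ = V j.castSucc ∨ derivative ∘ V j.succ = 0) :
    derivative V.det = (V.updateRow 0 (derivative ∘ V 0)).det ∧
    derivative (derivative V.det) =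
      (V.updateRow 0 (derivative ∘ derivative ∘ V 0)).det +
        ((V.updateRow 0 (derivative ∘ V 0)).updateRow 1 (derivative ∘ V 1)).det ∧
    ∑ j, (V.updateRow j (fun i => derivative (derivative (V j i)))).det =
      (V.updateRow 0 (derivative ∘ derivative ∘ V 0)).det -
        ((V.updateRow 0 (derivative ∘ V 0)).updateRow 1 (derivative ∘ V 1)).det := by
  have hrow (M : Matrix (Fin (k + 2)) (Fin (k + 2)) R[X]) (j : Fin (k + 2))
      (v : Fin (k + 2) → R[X]) (h : v = 0 ∨ ∃ l, l ≠ j ∧ v = M l) :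
      (M.updateRow j v).det = 0 := by
    rcases h with rfl | ⟨l, hl, rfl⟩
    · exact Matrix.det_eq_zero_of_row_eq_zero j (by simp)
    · refine Matrix.det_zero_of_row_eq hl ?_
      rw [Matrix.updateRow_self, Matrix.updateRow_ne hl]
  have h1 : derivative V.det = (V.updateRow 0 (derivative ∘ V 0)).det := by
    rw [Matrix.derivative_det, Fin.sum_univ_succ, Finset.sum_eq_zero, add_zero]
    · rfl
    intro j _
    refine hrow _ _ _ ?_
    rcases hV j with h | h
    · exact Or.inr ⟨j.castSucc, by simp [Fin.ext_iff], h⟩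
    · exact Or.inl h
  refine ⟨h1, ?_, ?_⟩
  · rw [h1, Matrix.derivative_det, Fin.sum_univ_succ, Fin.sum_univ_succ, Finset.sum_eq_zero,
      add_zero]
    · congr 2
      · rw [Matrix.updateRow_idem, Matrix.updateRow_self]
        rfl
    intro j _
    refine hrow _ _ _ ?_
    rw [Matrix.updateRow_ne (by simp [Fin.ext_iff])]
    rcases hV j.succ with h | h
    · refine Or.inr ⟨j.succ.castSucc, by simp [Fin.ext_iff], ?_⟩
      rw [Matrix.updateRow_ne (by simp [Fin.ext_iff])]
      exact h
    · exact Or.inl h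
  · rw [Fin.sum_univ_succ, Fin.sum_univ_succ, Finset.sum_eq_zero, add_zero, sub_eq_add_neg]
    · congr 1
      rw [Fin.succ_zero_eq_one]
      rcases hV 0 with h | h
      · rw [Fin.succ_zero_eq_one, Fin.castSucc_zero] at h
        have h' : (fun i => derivative (derivative (V 1 i))) = derivative ∘ V 0 := by
          rw [← h]
          rfl
        rw [h, h', Matrix.det_updateRow_updateRow_self V (by simp), neg_neg]
      · rw [Fin.succ_zero_eq_one] at h
        have h' : (fun i => derivative (derivative (V 1 i))) = 0 := by
          ext1 i
          have := congrFun h i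
          simp only [Function.comp_apply, Pi.zero_apply] at this ⊢
          rw [this, derivative_zero]
        rw [h, hrow _ _ _ (Or.inl h'), hrow _ _ _ (Or.inl rfl), neg_zero]
    intro j _
    refine hrow _ _ _ ?_
    rcases hV j.succ with h | h
    · have h' : (fun i => derivative (derivative (V j.succ.succ i))) =
          derivative ∘ V j.castSucc.succ := by
        rw [Fin.succ_castSucc, ← h]
        rfl
      rw [h']
      rcases hV j.castSucc with h2 | h2
      · exact Or.inr ⟨j.castSucc.castSucc, by simp [Fin.ext_iff]; omega, h2⟩
      · exact Or.inl h2
    · refine Or.inl ?_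
      ext1 i
      have := congrFun h i
      simp only [Function.comp_apply, Pi.zero_apply] at this ⊢
      rw [this, derivative_zero]

open Polynomial in
/-- Bilinear equation for determinants whose rows form overlapping derivative chains and whose
entries satisfy the Hermite equation. -/
theorem hirota3_det {k : ℕ} (U W : Matrix (Fin (k + 2)) (Fin (k + 2)) ℂ[X])
    (a a' b : Fin (k + 2) → ℂ) (c : ℂ)
    (hUW : ∀ j : Fin (k + 1), W j.succ = U j.castSucc)
    (hU0 : derivative ∘ U 0 = W 0)
    (hU : ∀ j : Fin (k + 1), derivative ∘ U j.succ = U j.castSucc ∨ derivative ∘ U j.succ = 0)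
    (hW : ∀ j : Fin (k + 1), derivative ∘ W j.succ = W j.castSucc)
    (hUe : ∀ j i, derivative (derivative (U j i)) =
      C (3 * (a j - b i)) * U j i - 3 * X * derivative (U j i))
    (hWe : ∀ j i, derivative (derivative (W j i)) =
      C (3 * (a' j - b i)) * W j i - 3 * X * derivative (W j i))
    (hc : c = 3 * (∑ j, a j - ∑ j, a' j)) :
    hirota3 c U.det W.det = 0 := by
  have euler (V : Matrix (Fin (k + 2)) (Fin (k + 2)) ℂ[X]) (a : Fin (k + 2) → ℂ)
      (hV : ∀ j i, derivative (derivative (V j i)) =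
        C (3 * (a j - b i)) * V j i - 3 * X * derivative (V j i)) :
      ∑ j, (V.updateRow j (fun i => derivative (derivative (V j i)))).det =
        C (3 * (∑ j, a j - ∑ i, b i)) * V.det - 3 * X * derivative V.det := by
    have h1 := Matrix.sum_det_updateRow_weight V (fun j => C (a j)) (fun i => C (b i))
    have h2 (j : Fin (k + 2)) :
        (V.updateRow j (fun i => derivative (derivative (V j i)))).det =
          3 * (V.updateRow j (fun i => (C (a j) - C (b i)) * V j i)).det -
            3 * X * (V.updateRow j (fun i => derivative (V j i))).det := by
      have h3 : (fun i => derivative (derivative (V j i))) =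
          (3 : ℂ[X]) • (fun i => (C (a j) - C (b i)) * V j i) +
            (-(3 * X) : ℂ[X]) • (fun i => derivative (V j i)) := by
        ext1 i
        simp only [hV, Pi.add_apply, Pi.smul_apply, smul_eq_mul, C_mul, C_sub, C_ofNat]
        ring
      rw [h3, Matrix.det_updateRow_add, Matrix.det_updateRow_smul, Matrix.det_updateRow_smul]
      ring
    rw [Finset.sum_congr rfl fun j _ => h2 j, Finset.sum_sub_distrib, ← Finset.mul_sum,
      ← Finset.mul_sum, h1, Matrix.derivative_det, C_mul, C_sub, map_sum, map_sum, C_ofNat,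
      mul_assoc 3 (_ - _)]
  obtain ⟨hF1, hF2, hF3⟩ := derivative_det_of_chain U hU
  obtain ⟨hG1, hG2, hG3⟩ := derivative_det_of_chain W fun j => Or.inl (hW j)
  have hFe := euler U a hUe
  have hGe := euler W a' hWe
  have hP := Matrix.plucker_three_term U W hUW (derivative ∘ W 0)
  have hW1 : derivative ∘ W 1 = W 0 := hW 0
  have hswap : ((W.updateRow 0 (derivative ∘ W 0)).updateRow 1 (W 0)).det =
      -(W.updateRow 1 (derivative ∘ W 0)).det :=
    Matrix.det_updateRow_updateRow_self W (by simp) _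
  rw [hU0] at hF1 hF2 hF3
  rw [hW1, hswap] at hG2 hG3
  have hcC : C c = C (3 * (∑ j, a j - ∑ i, b i)) - C (3 * (∑ j, a' j - ∑ i, b i)) := by
    rw [← C_sub, hc]
    congr 1
    ring
  rw [hirota3, hcC]
  rw [← hF1, ← hG1] at hP
  rw [hFe] at hF3
  rw [hGe] at hG3
  linear_combination W.det * (hF2 + hF3) + U.det * (hG2 - hG3) + 2 * hP

theorem hRect_eq_det_rows (m n : ℕ) :
    hRect m n = Matrix.det (Matrix.of fun j i : Fin m => p2Z (1 / 6) ((n : ℤ) + j - i)) := by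
  rw [hRect, ← Matrix.det_transpose]
  congr 1
  ext1 j i
  simp only [Matrix.transpose_apply, Matrix.of_apply]
  congr 1
  ring

theorem hRect_zero_left (n : ℕ) : hRect 0 n = 1 := by
  simp [hRect]

theorem hRect_one_left (n : ℕ) : hRect 1 n = p2Z (1 / 6) n := by
  simp [hRect]

open Polynomial in
theorem derivative_comp_p2Z_row {k : ℕ} (r s : ℤ) (h : r = s + 1) :
    (derivative ∘ fun i : Fin k => p2Z (1 / 6) (r - i)) = fun i : Fin k => p2Z (1 / 6) (s - i) := by
  ext1 i
  rw [Function.comp_apply, derivative_p2Z, h]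
  congr 1
  ring

open Polynomial in
theorem hirota3_hRect_succ_right (m n : ℕ) :
    hirota3 (3 * (m : ℂ)) (hRect m (n + 1)) (hRect m n) = 0 := by
  match m with
  | 0 => simp [hRect_zero_left, hirota3]
  | 1 =>
    have h1 := derivative_derivative_p2Z (n + 1)
    have h2 := derivative_derivative_p2Z n
    have h3 := derivative_p2Z (1 / 6) (n + 1)
    rw [add_sub_cancel_right] at h3
    rw [hRect_one_left, hRect_one_left, hirota3]
    push_cast at h1 h2 ⊢
    simp only [C_mul, C_add, C_1, mul_one, C_ofNat] at h1 h2 ⊢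
    rw [h3] at h1 ⊢
    linear_combination p2Z (1 / 6) (n + 1) * h2 - p2Z (1 / 6) n * h1
  | k + 2 =>
    rw [hRect_eq_det_rows, hRect_eq_det_rows]
    refine hirota3_det _ _ (fun j => n + 1 + j) (fun j => n + j) (fun i => i) _ ?_ ?_ ?_ ?_ ?_ ?_ ?_
    · intro j
      ext1 i
      simp only [Matrix.of_apply, Fin.val_succ, Fin.val_castSucc]
      congr 1
      push_cast
      ring
    · exact derivative_comp_p2Z_row _ _ (by push_cast; ring)
    · exact fun j => Or.inl (derivative_comp_p2Z_row _ _ (by simp; ring))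
    · exact fun j => derivative_comp_p2Z_row _ _ (by simp; ring)
    · intro j i
      rw [Matrix.of_apply, derivative_derivative_p2Z]
      push_cast
      rfl
    · intro j i
      rw [Matrix.of_apply, derivative_derivative_p2Z]
      push_cast
      rfl
    · simp only [← Finset.sum_sub_distrib]
      simp

theorem Matrix.det_of_last_row_eq_single {R : Type*} [CommRing R] {m : ℕ}
    (U : Matrix (Fin (m + 1)) (Fin (m + 1)) R) (l : Fin (m + 1)) (s : R)
    (h : U (Fin.last m) = Pi.single l s) :
    U.det = (-1) ^ (m + (l : ℕ)) * s * (U.submatrix Fin.castSucc l.succAbove).det := by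
  rw [Matrix.det_succ_row U (Fin.last m), Finset.sum_eq_single l]
  · rw [h, Pi.single_eq_same, Fin.val_last, Fin.succAbove_last]
  · intro i _ hi
    simp [h, hi]
  · simp

open Polynomial in
/-- Both mixed bilinear equations come from bordering `h_{m,n+1}` by a multiple of a unit row. -/
theorem hirota3_bordered (k n : ℕ) (s : ℂ) (l : Fin (k + 2))
    (U : Matrix (Fin (k + 2)) (Fin (k + 2)) ℂ[X])
    (hA : ∀ j : Fin (k + 1), U j.castSucc =
      fun i : Fin (k + 2) => p2Z (1 / 6) ((n : ℤ) + 1 + j - i))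
    (hl : U (Fin.last (k + 1)) = Pi.single l (C s)) :
    hirota3 (3 * ((l : ℕ) - (n : ℂ))) U.det (hRect (k + 2) n) = 0 := by
  rw [hRect_eq_det_rows]
  refine hirota3_det U _ (Fin.snoc (α := fun _ => ℂ) (fun j : Fin (k + 1) => (n : ℂ) + 1 + j) l)
    (fun j => n + j) (fun i => i) _ ?_ ?_ ?_ ?_ ?_ ?_ ?_
  · intro j
    ext1 i
    simp only [Matrix.of_apply, Fin.val_succ, hA]
    congr 1
    push_cast
    ring
  · rw [← Fin.castSucc_zero, hA]
    exact derivative_comp_p2Z_row _ _ (by simp)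
  · intro j
    rw [hA]
    cases j using Fin.lastCases with
    | last =>
      right
      rw [Fin.succ_last, hl]
      ext1 i
      rw [Function.comp_apply, Pi.single_apply]
      split_ifs <;> simp
    | cast j =>
      left
      rw [Fin.succ_castSucc, hA]
      exact derivative_comp_p2Z_row _ _ (by simp; ring)
  · exact fun j => derivative_comp_p2Z_row _ _ (by simp; ring)
  · intro j i
    cases j using Fin.lastCases with
    | last =>
      rw [hl, Fin.snoc_last, Pi.single_apply]
      split_ifs with h
      · simp [h]
      · simp
    | cast j =>
      rw [hA, Fin.snoc_castSucc, derivative_derivative_p2Z]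
      push_cast
      rfl
  · intro j i
    rw [Matrix.of_apply, derivative_derivative_p2Z]
    push_cast
    rfl
  · rw [Fin.sum_univ_castSucc, Fin.sum_univ_succ (fun j : Fin (k + 2) => (n : ℂ) + (j : ℕ))]
    simp only [Fin.snoc_castSucc, Fin.snoc_last, Fin.val_succ, Fin.val_zero]
    have h : ∑ j : Fin (k + 1), ((n : ℂ) + 1 + (j : ℕ)) =
        ∑ j : Fin (k + 1), ((n : ℂ) + ((j : ℕ) + 1 : ℕ)) :=
      Finset.sum_congr rfl fun j _ => by push_cast; ring
    rw [h]
    push_cast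
    ring

open Polynomial in
theorem hirota3_hRect_mul_det (k n : ℕ) (s : ℂ) (l : Fin (k + 2)) :
    hirota3 (3 * ((l : ℕ) - (n : ℂ)))
      ((-1) ^ (k + 1 + (l : ℕ)) * C s * (Matrix.of fun j i : Fin (k + 1) =>
        p2Z (1 / 6) ((n : ℤ) + 1 + j - (l.succAbove i : ℕ))).det) (hRect (k + 2) n) = 0 := by
  let U : Matrix (Fin (k + 2)) (Fin (k + 2)) ℂ[X] :=
    Fin.snoc (α := fun _ => Fin (k + 2) → ℂ[X])
      (fun (j : Fin (k + 1)) i => p2Z (1 / 6) ((n : ℤ) + 1 + j - i)) (Pi.single l (C s))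
  have hA (j : Fin (k + 1)) : U j.castSucc =
      fun i : Fin (k + 2) => p2Z (1 / 6) ((n : ℤ) + 1 + j - i) :=
    Fin.snoc_castSucc (α := fun _ => Fin (k + 2) → ℂ[X]) _ _ j
  have hl : U (Fin.last (k + 1)) = Pi.single l (C s) :=
    Fin.snoc_last (α := fun _ => Fin (k + 2) → ℂ[X]) _ _
  have h := hirota3_bordered k n s l U hA hl
  rw [Matrix.det_of_last_row_eq_single U l _ hl] at h
  convert h using 4
  ext1 j i
  rw [Matrix.submatrix_apply, hA, Matrix.of_apply]

open Polynomial in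
theorem hirota3_one_hRect_one (n : ℕ) :
    hirota3 (-(3 * (n : ℂ))) 1 (hRect 1 n) = 0 := by
  have h := derivative_derivative_p2Z n
  rw [hRect_one_left, hirota3]
  simp only [Int.cast_natCast] at h
  rw [h]
  simp only [derivative_one, C_neg, derivative_zero]
  ring

/-- **Bilinear equations for the generalized Hermite polynomials**
`h_{m,n}(x) = S_{(nᵐ)}(x, 1/6)`: for all `m, n ≥ 0`,
`(Dₓ² − 3x Dₓ + 3m) h_{m,n+1}·h_{m,n} = 0`,
`(Dₓ² − 3x Dₓ + 3(m−n)) h_{m,n+1}·h_{m+1,n} = 0`, and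
`(Dₓ² − 3x Dₓ − 3n) h_{m,n}·h_{m+1,n} = 0`. -/
theorem generalized_hermite_bilinear (m n : ℕ) :
    hirota3 (3 * (m : ℂ)) (hRect m (n + 1)) (hRect m n) = 0 ∧
    hirota3 (3 * ((m : ℂ) - (n : ℂ))) (hRect m (n + 1)) (hRect (m + 1) n) = 0 ∧
    hirota3 (-(3 * (n : ℂ))) (hRect m n) (hRect (m + 1) n) = 0 := by
  refine ⟨hirota3_hRect_succ_right m n, ?_, ?_⟩
  · cases m with
    | zero => simpa [hRect_zero_left] using hirota3_one_hRect_one n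
    | succ k =>
      have h := hirota3_hRect_mul_det k n 1 (Fin.last (k + 1))
      convert h using 2
      · simp
      · rw [Fin.val_last, ← two_mul, hRect_eq_det_rows]
        simp
  · cases m with
    | zero => simpa [hRect_zero_left] using hirota3_one_hRect_one n
    | succ k =>
      have h := hirota3_hRect_mul_det k n ((-1) ^ (k + 1)) 0
      convert h using 2
      · simp
      · rw [hRect_eq_det_rows, Fin.val_zero, add_zero, Polynomial.C_pow, Polynomial.C_neg,
          Polynomial.C_1, ← mul_pow, neg_one_mul, neg_neg, one_pow, one_mul]
        congr 1
        ext1 j i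
        simp only [Matrix.of_apply, Fin.succAbove_zero, Fin.val_succ]
        congr 1
        push_cast
        ring
end

section
/- For all integers m, n ≥ 1, the polynomial h_{m,n}(x) = S_{(n^m)}(x, 1/6) has degree mn in x, and its leading coefficient (the coefficient of x^{mn}) equals (m−1)^! · (n−1)^! / (m+n−1)^!, where k^! denotes the superfactorial k^! = k!·(k−1)!·⋯·2!·1! (with 0^! = 1). Equivalently, the product of the hook lengths of the rectangular partition (n^m) equals (m+n−1)^! / ((m−1)^!·(n−1)^!). -/
/-- The superfactorial `k^! = k!·(k−1)!·⋯·2!·1!`, with `0^! = 1`. -/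
def superFactorial : ℕ → ℕ
  | 0 => 1
  | k + 1 => Nat.factorial (k + 1) * superFactorial k

open Polynomial in
theorem natDegree_prod_le_of_forall_le {ι R : Type*} [CommSemiring R] (s : Finset ι)
    (f : ι → R[X]) (d : ι → ℕ) (h : ∀ i ∈ s, (f i).natDegree ≤ d i) :
    (∏ i ∈ s, f i).natDegree ≤ ∑ i ∈ s, d i :=
  (natDegree_prod_le s f).trans (Finset.sum_le_sum h)

open Polynomial in
theorem coeff_prod_sum_of_forall_natDegree_le {ι R : Type*} [CommSemiring R] (s : Finset ι)
    (f : ι → R[X]) (d : ι → ℕ) (h : ∀ i ∈ s, (f i).natDegree ≤ d i) :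
    (∏ i ∈ s, f i).coeff (∑ i ∈ s, d i) = ∏ i ∈ s, (f i).coeff (d i) := by
  classical
  induction s using Finset.induction_on with
  | empty => simp
  | insert a s ha ih =>
    rw [Finset.forall_mem_insert] at h
    rw [Finset.prod_insert ha, Finset.sum_insert ha, Finset.prod_insert ha,
      coeff_mul_add_eq_of_natDegree_le h.1 (natDegree_prod_le_of_forall_le s f d h.2), ih h.2]

theorem sum_toNat_sub_perm_add (m n : ℕ) (σ : Equiv.Perm (Fin m))
    (h : ∀ i, 0 ≤ (n : ℤ) - (σ i : ℕ) + (i : ℕ)) :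
    ∑ i, ((n : ℤ) - (σ i : ℕ) + (i : ℕ)).toNat = m * n := by
  zify
  simp only [Int.toNat_of_nonneg (h _), Finset.sum_add_distrib, Finset.sum_sub_distrib]
  rw [Equiv.sum_comp σ fun i : Fin m => ((i : ℕ) : ℤ)]
  simp

open Polynomial in
/-- A Toeplitz determinant of polynomials `p k` of degree at most `k` has degree at most `m * n`. -/
theorem natDegree_det_toeplitz_le {R : Type*} [CommRing R] (p : ℤ → R[X])
    (hneg : ∀ k < 0, p k = 0) (hdeg : ∀ k, (p k).natDegree ≤ k.toNat) (m n : ℕ) :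
    (Matrix.det (Matrix.of fun i j : Fin m => p ((n : ℤ) - (i : ℕ) + (j : ℕ)))).natDegree
      ≤ m * n := by
  rw [Matrix.det_apply]
  refine natDegree_sum_le_of_forall_le _ _ fun σ _ => (natDegree_smul_le _ _).trans ?_
  simp only [Matrix.of_apply]
  by_cases h : ∀ i, 0 ≤ (n : ℤ) - (σ i : ℕ) + (i : ℕ)
  · exact (natDegree_prod_le_of_forall_le _ _ _ fun i _ => hdeg _).trans
      (sum_toNat_sub_perm_add m n σ h).le
  · push Not at h
    obtain ⟨i, hi⟩ := h
    rw [Finset.prod_eq_zero (Finset.mem_univ i) (hneg _ hi)]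
    simp

open Polynomial in
/-- The top coefficient of a Toeplitz determinant of polynomials is the determinant of the
top coefficients. -/
theorem coeff_det_toeplitz {R : Type*} [CommRing R] (p : ℤ → R[X])
    (hneg : ∀ k < 0, p k = 0) (hdeg : ∀ k, (p k).natDegree ≤ k.toNat) (m n : ℕ) :
    (Matrix.det (Matrix.of fun i j : Fin m => p ((n : ℤ) - (i : ℕ) + (j : ℕ)))).coeff (m * n) =
      Matrix.det (Matrix.of fun i j : Fin m =>
        (p ((n : ℤ) - (i : ℕ) + (j : ℕ))).coeff ((n : ℤ) - (i : ℕ) + (j : ℕ)).toNat) := by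
  rw [Matrix.det_apply, Matrix.det_apply, finsetSum_coeff]
  refine Finset.sum_congr rfl fun σ _ => ?_
  rw [coeff_smul]
  congr 1
  simp only [Matrix.of_apply]
  by_cases h : ∀ i, 0 ≤ (n : ℤ) - (σ i : ℕ) + (i : ℕ)
  · rw [← coeff_prod_sum_of_forall_natDegree_le _ _ _ fun i _ => hdeg _,
      sum_toNat_sub_perm_add m n σ h]
  · push Not at h
    obtain ⟨i, hi⟩ := h
    rw [Finset.prod_eq_zero (Finset.mem_univ i) (hneg _ hi),
      Finset.prod_eq_zero (Finset.mem_univ i) (by rw [hneg _ hi, coeff_zero]), coeff_zero]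

theorem p2_natDegree_le (c : ℂ) (n : ℕ) : (p2 c n).natDegree ≤ n :=
  Polynomial.natDegree_sum_le_of_forall_le _ _ fun _ _ =>
    (Polynomial.natDegree_C_mul_X_pow_le _ _).trans (Nat.sub_le _ _)

theorem p2_coeff_self (c : ℂ) (n : ℕ) : (p2 c n).coeff n = 1 / (n.factorial : ℂ) := by
  rw [p2, Polynomial.finsetSum_coeff, Finset.sum_eq_single 0]
  · simp
  · intro j hj hj0
    rw [Finset.mem_range] at hj
    rw [Polynomial.coeff_C_mul_X_pow, if_neg (by omega)]
  · simp

theorem p2Z_of_neg (c : ℂ) (k : ℤ) (hk : k < 0) : p2Z c k = 0 :=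
  if_neg (not_le.mpr hk)

theorem p2Z_natDegree_le (c : ℂ) (k : ℤ) : (p2Z c k).natDegree ≤ k.toNat := by
  unfold p2Z
  split_ifs
  · exact p2_natDegree_le c _
  · simp

theorem p2Z_coeff_toNat (c : ℂ) (n i j : ℕ) :
    (p2Z c ((n : ℤ) - i + j)).coeff ((n : ℤ) - i + j).toNat =
      1 / ((n + j).factorial : ℂ) * ((n + j).descFactorial i : ℂ) := by
  rcases lt_or_ge (n + j) i with h | h
  · rw [p2Z_of_neg _ _ (by omega), Nat.descFactorial_of_lt h]
    simp
  · have hk : (n : ℤ) - i + j = ((n + j - i : ℕ) : ℤ) := by omega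
    rw [hk, p2Z, if_pos (by omega), Int.toNat_natCast, p2_coeff_self,
      ← Nat.factorial_mul_descFactorial h]
    have h1 : ((n + j - i).factorial : ℂ) ≠ 0 := by exact_mod_cast Nat.factorial_ne_zero _
    have h2 : ((n + j).descFactorial i : ℂ) ≠ 0 := by
      exact_mod_cast (Nat.descFactorial_pos.mpr h).ne'
    push_cast
    field_simp

theorem superFactorial_eq (k : ℕ) : superFactorial k = k.superFactorial := by
  induction k with
  | zero => rfl
  | succ k ih => rw [superFactorial, ih, Nat.superFactorial_succ]

theorem superFactorial_pos (k : ℕ) : 0 < superFactorial k := by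
  induction k with
  | zero => exact Nat.one_pos
  | succ k ih => exact Nat.mul_pos (Nat.factorial_pos _) ih

theorem prod_factorial_eq_superFactorial (m : ℕ) :
    ∏ i ∈ Finset.range m, i.factorial = superFactorial (m - 1) := by
  induction m with
  | zero => rfl
  | succ m ih =>
    rw [Finset.prod_range_succ, ih]
    cases m with
    | zero => rfl
    | succ m => simp [superFactorial, mul_comm]

theorem prod_factorial_add_mul_superFactorial (m n : ℕ) :
    (∏ i ∈ Finset.range m, (n + i).factorial) * superFactorial (n - 1) =
      superFactorial (m + n - 1) := by
  rw [← prod_factorial_eq_superFactorial, ← prod_factorial_eq_superFactorial, add_comm m n,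
    Finset.prod_range_add, mul_comm]

theorem det_descFactorial (m n : ℕ) :
    Matrix.det (Matrix.of fun i j : Fin m => ((n + j : ℕ).descFactorial i : ℂ)) =
      superFactorial (m - 1) := by
  cases m with
  | zero => simp [superFactorial]
  | succ m =>
    have h := Matrix.det_eval_matrixOfPolynomials_eq_det_vandermonde
      (fun j : Fin (m + 1) => (j : ℂ) + n) (fun i => descPochhammer ℂ i)
      (fun i => descPochhammer_natDegree ℂ i) (fun i => monic_descPochhammer ℂ i)
    rw [Matrix.det_vandermonde_add, Matrix.det_vandermonde_id_eq_superFactorial] at h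
    rw [Nat.add_sub_cancel, superFactorial_eq, h, ← Matrix.det_transpose]
    congr 1
    ext i j
    simp only [Matrix.transpose_apply, Matrix.of_apply]
    rw [← descPochhammer_eval_eq_descFactorial]
    push_cast
    rw [add_comm]

theorem hRect_coeff (m n : ℕ) :
    (hRect m n).coeff (m * n) =
      ((superFactorial (m - 1) : ℂ) * (superFactorial (n - 1) : ℂ)) /
        (superFactorial (m + n - 1) : ℂ) := by
  rw [hRect, coeff_det_toeplitz _ (p2Z_of_neg _) (p2Z_natDegree_le _)]
  simp only [p2Z_coeff_toNat]
  have h := Matrix.det_mul_row (fun j : Fin m => 1 / ((n + j : ℕ).factorial : ℂ))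
    (Matrix.of fun i j : Fin m => ((n + j : ℕ).descFactorial i : ℂ))
  simp only [Matrix.of_apply] at h
  rw [h, det_descFactorial, ← prod_factorial_add_mul_superFactorial,
    Fin.prod_univ_eq_prod_range (fun j => 1 / ((n + j : ℕ).factorial : ℂ)),
    Finset.prod_div_distrib, Finset.prod_const_one]
  have h1 : (superFactorial (n - 1) : ℂ) ≠ 0 := by exact_mod_cast (superFactorial_pos _).ne'
  have h2 : (∏ i ∈ Finset.range m, ((n + i).factorial : ℂ)) ≠ 0 :=
    Finset.prod_ne_zero_iff.mpr fun i _ => by exact_mod_cast Nat.factorial_ne_zero _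
  push_cast
  field_simp

theorem factorial_mul_prod_hook (n k : ℕ) :
    k.factorial * ∏ j ∈ Finset.range n, (n - j + k) = (n + k).factorial := by
  rw [add_comm n k, ← Nat.factorial_mul_ascFactorial, Nat.ascFactorial_eq_prod_range,
    ← Finset.prod_range_reflect]
  congr 1
  refine Finset.prod_congr rfl fun j hj => ?_
  rw [Finset.mem_range] at hj
  omega

theorem conjPart_const {n j : ℕ} (m : ℕ) (hj : j < n) : conjPart m (fun _ => n) j = m := by
  simp [conjPart, Nat.succ_le_of_lt hj]

theorem hookProd_rect_mul (m n : ℕ) :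
    hookProd m (fun _ => n) * (superFactorial (m - 1) * superFactorial (n - 1)) =
      superFactorial (m + n - 1) := by
  have h : hookProd m (fun _ => n) =
      ∏ i ∈ Finset.range m, ∏ j ∈ Finset.range n, (n - j + i) := by
    rw [hookProd, ← Finset.prod_range_reflect]
    refine Finset.prod_congr rfl fun i hi => Finset.prod_congr rfl fun j hj => ?_
    rw [Finset.mem_range] at hi hj
    rw [conjPart_const m hj]
    omega
  rw [h, ← prod_factorial_add_mul_superFactorial, ← mul_assoc,
    ← prod_factorial_eq_superFactorial m, mul_comm (∏ i ∈ Finset.range m, _),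
    ← Finset.prod_mul_distrib]
  simp only [factorial_mul_prod_hook]


/-- **Degree and leading coefficient of the generalized Hermite polynomials:** for
`m, n ≥ 1`, `h_{m,n}(x) = S_{(nᵐ)}(x, 1/6)` has degree `mn` and leading coefficient
`(m−1)^!·(n−1)^!/(m+n−1)^!` (superfactorials); equivalently, the product of the hook
lengths of the rectangular partition `(nᵐ)` is `(m+n−1)^!/((m−1)^!·(n−1)^!)`. -/
theorem generalized_hermite_degree_leadingCoeff (m n : ℕ) (hm : 1 ≤ m) (hn : 1 ≤ n) :
    (hRect m n).natDegree = m * n ∧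
    (hRect m n).leadingCoeff =
      ((superFactorial (m - 1) : ℂ) * (superFactorial (n - 1) : ℂ)) /
        (superFactorial (m + n - 1) : ℂ) ∧
    ((hookProd m (fun _ => n) : ℚ) =
      (superFactorial (m + n - 1) : ℚ) /
        ((superFactorial (m - 1) : ℚ) * (superFactorial (n - 1) : ℚ))) := by
  have hsf : ∀ k, superFactorial k ≠ 0 := fun k => (superFactorial_pos k).ne'
  have hdeg : (hRect m n).natDegree = m * n := by
    refine Polynomial.natDegree_eq_of_le_of_coeff_ne_zero
      (natDegree_det_toeplitz_le _ (p2Z_of_neg _) (p2Z_natDegree_le _) m n) ?_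
    rw [hRect_coeff]
    exact div_ne_zero (mul_ne_zero (Nat.cast_ne_zero.mpr (hsf _)) (Nat.cast_ne_zero.mpr (hsf _)))
      (Nat.cast_ne_zero.mpr (hsf _))
  refine ⟨hdeg, ?_, ?_⟩
  · rw [Polynomial.leadingCoeff, hdeg, hRect_coeff]
  · rw [eq_div_iff (mul_ne_zero (Nat.cast_ne_zero.mpr (hsf _)) (Nat.cast_ne_zero.mpr (hsf _)))]
    exact_mod_cast hookProd_rect_mul m n
end
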